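/- Let b be a rational function in the closed unit ball of H∞ with ‖b‖∞ = 1 that is not a finite Blaschke product. Let φ ∈ H(b) ∩ ball(H∞) with φ(ξ_j) ∈ Z_T(a) for 1 ≤ j ≤ p and φ(ξ_j) ∈ D for p+1 ≤ j ≤ n, and let u = (a₁ ∘ φ) · ∏_{j=p+1}^n (φ − φ(ξ_j))^{m_j} / a₁. Then C_φ : H(b) → H(b) is Hilbert–Schmidt if and only if ∫_T |u(ξ)|²/(1 − |φ(ξ)|²) dm(ξ) < ∞. -/

import Mathlib

open Complex MeasureTheory Set Filter

noncomputable section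

attribute [local instance] Classical.propDecidable

/-- The open unit disk in `ℂ`. -/
def unitDisk : Set ℂ := Metric.ball 0 1

/-- The unit circle in `ℂ`. -/
def unitCircle : Set ℂ := Metric.sphere 0 1

/-- Membership in `H^∞`: analytic and bounded on the unit disk. -/
def MemHinf (f : ℂ → ℂ) : Prop :=
  DifferentiableOn ℂ f unitDisk ∧ ∃ C : ℝ, ∀ z ∈ unitDisk, ‖f z‖ ≤ C

/-- Membership in the closed unit ball of `H^∞`. -/
def MemBallHinf (f : ℂ → ℂ) : Prop :=
  DifferentiableOn ℂ f unitDisk ∧ ∀ z ∈ unitDisk, ‖f z‖ ≤ 1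

/-- `f` agrees on the closed unit disk with a rational function without poles there. -/
def IsRationalOnDisk (f : ℂ → ℂ) : Prop :=
  ∃ P Q : Polynomial ℂ, ∀ z ∈ Metric.closedBall (0:ℂ) 1,
    Q.eval z ≠ 0 ∧ f z = P.eval z / Q.eval z

/-- `f` is a finite Blaschke product (multiplicities are encoded by repetition). -/
def IsFiniteBlaschke (f : ℂ → ℂ) : Prop :=
  ∃ (γ : ℂ) (k : ℕ) (lam : Fin k → ℂ), ‖γ‖ = 1 ∧ (∀ i, lam i ∈ unitDisk) ∧
    ∀ z ∈ unitDisk, f z = γ * ∏ i, (z - lam i) / (1 - (starRingEnd ℂ) (lam i) * z)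

/-- The `k`-th Taylor coefficient of `f` at the origin. -/
def taylorCoeff (f : ℂ → ℂ) (k : ℕ) : ℂ := iteratedDeriv k f 0 / k.factorial

/-- Membership in the Hardy space `H²` (square-summable Taylor coefficients). -/
def MemH2 (f : ℂ → ℂ) : Prop :=
  DifferentiableOn ℂ f unitDisk ∧ Summable fun k => ‖taylorCoeff f k‖ ^ 2

/-- The squared `H²` norm. -/
def h2NormSq (f : ℂ → ℂ) : ℝ := ∑' k, ‖taylorCoeff f k‖ ^ 2

/-- The `H²` inner product. -/
def h2Inner (f g : ℂ → ℂ) : ℂ :=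
  ∑' k, (starRingEnd ℂ) (taylorCoeff f k) * taylorCoeff g k

/-- The polynomial `a₁(z) = ∏ⱼ (z − ξⱼ)^{mⱼ}`. -/
def a1fun {n : ℕ} (ξ : Fin n → ℂ) (m : Fin n → ℕ) : ℂ → ℂ :=
  fun z => ∏ j, (z - ξ j) ^ (m j)

/-- A decomposition `f = a₁ g + q` with `g ∈ H²`, `deg q ≤ N − 1`, witnessing membership
in `H(b) = a₁H² ⊕ P_{N−1}`. -/
def HbDecompOf {n : ℕ} (ξ : Fin n → ℂ) (m : Fin n → ℕ)
    (f g : ℂ → ℂ) (q : Polynomial ℂ) : Prop :=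
  MemH2 g ∧ q.degree < ((∑ j, m j : ℕ) : WithBot ℕ) ∧
    ∀ z ∈ unitDisk, f z = a1fun ξ m z * g z + q.eval z

/-- Membership in `H(b) = a₁ H² ⊕ P_{N−1}` (description of `H(b)` for `b` rational,
not a finite Blaschke product, whose pythagorean mate has boundary zeros `ξ` with
multiplicities `m`). -/
def MemHb {n : ℕ} (ξ : Fin n → ℂ) (m : Fin n → ℕ) (f : ℂ → ℂ) : Prop :=
  ∃ gq : (ℂ → ℂ) × Polynomial ℂ, HbDecompOf ξ m f gq.1 gq.2

/-- The (unique) decomposition of a member of `H(b)`. -/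
def hbDecomp {n : ℕ} (ξ : Fin n → ℂ) (m : Fin n → ℕ) (f : ℂ → ℂ) :
    (ℂ → ℂ) × Polynomial ℂ :=
  if h : MemHb ξ m f then h.choose else (0, 0)

/-- The squared norm `⦀a₁g + q⦀² = ‖g‖²_{H²} + ‖q‖²_{H²}` on `H(b)`. -/
def hbNormSq {n : ℕ} (ξ : Fin n → ℂ) (m : Fin n → ℕ) (f : ℂ → ℂ) : ℝ :=
  h2NormSq (hbDecomp ξ m f).1 + h2NormSq fun z => ((hbDecomp ξ m f).2).eval z

/-- The inner product on `H(b)` induced by the decomposition. -/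
def hbInner {n : ℕ} (ξ : Fin n → ℂ) (m : Fin n → ℕ) (f g : ℂ → ℂ) : ℂ :=
  h2Inner (hbDecomp ξ m f).1 (hbDecomp ξ m g).1 +
    h2Inner (fun z => ((hbDecomp ξ m f).2).eval z)
      (fun z => ((hbDecomp ξ m g).2).eval z)

/-- The Stolz angle (non-tangential approach region) at a boundary point `ξ`. -/
def stolzAngle (ξ : ℂ) (M : ℝ) : Set ℂ := {z ∈ unitDisk | ‖z - ξ‖ ≤ M * (1 - ‖z‖)}

/-- `f` has non-tangential limit `L` at `ξ`. -/
def NTLimit (f : ℂ → ℂ) (ξ L : ℂ) : Prop :=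
  ∀ M : ℝ, 1 < M → Tendsto f (nhdsWithin ξ (stolzAngle ξ M)) (nhds L)

/-- Radial boundary value of `f` at `ζ` (junk value if the radial limit does not exist). -/
def bdryVal (f : ℂ → ℂ) (ζ : ℂ) : ℂ :=
  limUnder (nhdsWithin (1:ℝ) (Set.Iio 1)) fun r : ℝ => f ((r : ℂ) * ζ)

/-- The full setting: `b` is a rational function in the closed unit ball of `H^∞` with
`‖b‖_∞ = 1` which is not a finite Blaschke product; `a` is its pythagorean mate (rational,
outer — i.e. zero-free on the disk —, `a(0) > 0`, `|a|² + |b|² = 1` on the circle); the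
`ξ j` are the distinct zeros of `a` on the unit circle, with multiplicities `m j`. -/
structure RationalSetting (b a : ℂ → ℂ) (n : ℕ) (ξ : Fin n → ℂ) (m : Fin n → ℕ) :
    Prop where
  b_diff : DifferentiableOn ℂ b unitDisk
  b_rat : IsRationalOnDisk b
  b_le_one : ∀ z ∈ unitDisk, ‖b z‖ ≤ 1
  b_norm_one : sSup ((fun z => ‖b z‖) '' unitDisk) = 1
  b_not_fbp : ¬ IsFiniteBlaschke b
  a_diff : DifferentiableOn ℂ a unitDisk
  a_rat : IsRationalOnDisk a
  a_outer : ∀ z ∈ unitDisk, a z ≠ 0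
  a_zero_pos : 0 < (a 0).re ∧ (a 0).im = 0
  pyth : ∀ ζ ∈ unitCircle, ‖a ζ‖ ^ 2 + ‖b ζ‖ ^ 2 = 1
  zeros_mem : ∀ j, ξ j ∈ unitCircle
  zeros_inj : Function.Injective ξ
  mult_pos : ∀ j, 0 < m j
  factor : ∃ g : ℂ → ℂ, IsRationalOnDisk g ∧ (∀ ζ ∈ unitCircle, g ζ ≠ 0) ∧
    ∀ z ∈ Metric.closedBall (0:ℂ) 1, a z = a1fun ξ m z * g z

/-- The composition operator `C_φ` maps `H(b)` into itself and is bounded there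
(with respect to the equivalent norm `⦀·⦀_b`). -/
def CompBddHb {n : ℕ} (ξ : Fin n → ℂ) (m : Fin n → ℕ) (φ : ℂ → ℂ) : Prop :=
  (∀ f, MemHb ξ m f → MemHb ξ m fun z => f (φ z)) ∧
  ∃ C : ℝ, ∀ f, MemHb ξ m f →
    hbNormSq ξ m (fun z => f (φ z)) ≤ C * hbNormSq ξ m f

/-- The composition operator `C_φ` is compact on `H(b)`: it is bounded and the image of
every sequence in the unit ball has a subsequence whose image converges in `H(b)`. -/
def CompCompactHb {n : ℕ} (ξ : Fin n → ℂ) (m : Fin n → ℕ) (φ : ℂ → ℂ) : Prop :=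
  CompBddHb ξ m φ ∧
  ∀ f : ℕ → ℂ → ℂ, (∀ k, MemHb ξ m (f k) ∧ hbNormSq ξ m (f k) ≤ 1) →
    ∃ (κ : ℕ → ℕ) (g : ℂ → ℂ), StrictMono κ ∧ MemHb ξ m g ∧
      Tendsto (fun i => hbNormSq ξ m fun z => f (κ i) (φ z) - g z) atTop (nhds 0)

/-- The composition operator `C_φ` is Hilbert–Schmidt on `H(b)`: it is bounded and the sum
of `⦀C_φ e⦀²` over the orthonormal basis `{a₁ z^k}ₖ ∪ {z^j}_{j<N}` of
`(H(b), ⦀·⦀_b)` is finite (the finite part of the sum being automatically finite). -/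
def CompHSHb {n : ℕ} (ξ : Fin n → ℂ) (m : Fin n → ℕ) (φ : ℂ → ℂ) : Prop :=
  CompBddHb ξ m φ ∧
  Summable fun k : ℕ => hbNormSq ξ m fun z => a1fun ξ m (φ z) * φ z ^ k

/-- The weighted composition operator `W_{u,φ} f = u · (f ∘ φ)` maps `H²` boundedly
into itself. -/
def WCompBddH2 (u φ : ℂ → ℂ) : Prop :=
  (∀ f, MemH2 f → MemH2 fun z => u z * f (φ z)) ∧
  ∃ C : ℝ, ∀ f, MemH2 f →
    h2NormSq (fun z => u z * f (φ z)) ≤ C * h2NormSq f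

/-- The weighted composition operator `W_{u,φ}` is compact on `H²`. -/
def WCompCompactH2 (u φ : ℂ → ℂ) : Prop :=
  WCompBddH2 u φ ∧
  ∀ f : ℕ → ℂ → ℂ, (∀ k, MemH2 (f k) ∧ h2NormSq (f k) ≤ 1) →
    ∃ (κ : ℕ → ℕ) (g : ℂ → ℂ), StrictMono κ ∧ MemH2 g ∧
      Tendsto (fun i => h2NormSq fun z => u z * f (κ i) (φ z) - g z) atTop (nhds 0)

/-- The weighted composition operator `W_{u,φ}` is Hilbert–Schmidt on `H²`
(sum over the orthonormal basis `{z^k}` of `H²`). -/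
def WCompHSH2 (u φ : ℂ → ℂ) : Prop :=
  WCompBddH2 u φ ∧ Summable fun k : ℕ => h2NormSq fun z => u z * φ z ^ k

/-- The function `u = (a₁ ∘ φ) · ∏_{j ≥ p} (φ − φ(ξⱼ))^{mⱼ} / a₁`, where `Λ j = φ(ξ j)`
are the non-tangential limits of `φ` at the zeros of the mate. -/
def ufun {n : ℕ} (p : ℕ) (ξ : Fin n → ℂ) (m : Fin n → ℕ) (Λ : Fin n → ℂ)
    (φ : ℂ → ℂ) : ℂ → ℂ :=
  fun z => a1fun ξ m (φ z) *
    (∏ j ∈ Finset.univ.filter fun j : Fin n => p ≤ (j : ℕ), (φ z - Λ j) ^ (m j)) /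
      a1fun ξ m z

/-- The reproducing kernel of the de Branges–Rovnyak space `H(c)`:
`k_λ^c(z) = (1 − conj(c(λ)) c(z)) / (1 − conj(λ) z)`, as a function of the parameter `λ`
and the evaluation point `z`. -/
def rkKernel (c : ℂ → ℂ) (lam z : ℂ) : ℂ :=
  (1 - (starRingEnd ℂ) (c lam) * c z) / (1 - (starRingEnd ℂ) lam * z)

/-- `f` belongs to the reproducing kernel Hilbert space `H(c)` with squared norm at
most `t`: for all finite linear combinations of kernels,
`|⟨f, Σ αᵢ k_{λᵢ}⟩|² ≤ t · ‖Σ αᵢ k_{λᵢ}‖²`. -/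
def HbRKBound (c f : ℂ → ℂ) (t : ℝ) : Prop :=
  ∀ (k : ℕ) (lam α : Fin k → ℂ), (∀ i, lam i ∈ unitDisk) →
    ‖∑ i, (starRingEnd ℂ) (α i) * f (lam i)‖ ^ 2 ≤
      t * (∑ i, ∑ j, α i * (starRingEnd ℂ) (α j) * rkKernel c (lam i) (lam j)).re

/-- Membership in the de Branges–Rovnyak space `H(c)` (general RKHS definition). -/
def MemHbRK (c f : ℂ → ℂ) : Prop := ∃ t : ℝ, HbRKBound c f t

/-- `φ` has an angular derivative in the sense of Carathéodory at `ξ`: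
`φ` and `φ'` have non-tangential limits at `ξ` and `|φ(ξ)| = 1`. -/
def HasADC (φ : ℂ → ℂ) (ξ : ℂ) : Prop :=
  ∃ L L' : ℂ, ‖L‖ = 1 ∧ NTLimit φ ξ L ∧ NTLimit (deriv φ) ξ L'

/-- The measure `μ_{u,φ}(E) = ∫_{φ⁻¹(E) ∩ T} |u|² dm` (boundary values on the circle,
normalized Lebesgue measure). -/
def muMeas (u φ : ℂ → ℂ) (E : Set ℂ) : ENNReal :=
  (ENNReal.ofReal (2 * Real.pi))⁻¹ *
    ∫⁻ θ in Set.Ioc (0:ℝ) (2 * Real.pi),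
      (if bdryVal φ (Complex.exp (θ * Complex.I)) ∈ E then
        ENNReal.ofReal (‖bdryVal u (Complex.exp (θ * Complex.I))‖ ^ 2) else 0)

/-- `μ_{u,φ}` is a Carleson measure: `μ(S(ζ,r)) ≤ M r` for all Carleson windows
`S(ζ,r) = {z : |z| ≤ 1, |z − ζ| ≤ r}`, `ζ ∈ T`, `0 < r < 1`. -/
def IsCarleson (u φ : ℂ → ℂ) : Prop :=
  ∃ M : ℝ, 0 < M ∧ ∀ ζ ∈ unitCircle, ∀ r ∈ Set.Ioo (0:ℝ) 1,
    muMeas u φ (Metric.closedBall ζ r ∩ Metric.closedBall 0 1) ≤ ENNReal.ofReal (M * r)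

/-- `μ_{u,φ}` is a vanishing Carleson measure: `sup_{ζ∈T} μ(S(ζ,r))/r → 0` as `r → 0`. -/
def IsVanishingCarleson (u φ : ℂ → ℂ) : Prop :=
  ∀ ε > (0:ℝ), ∃ r₀ ∈ Set.Ioo (0:ℝ) 1, ∀ r ∈ Set.Ioo (0:ℝ) r₀, ∀ ζ ∈ unitCircle,
    muMeas u φ (Metric.closedBall ζ r ∩ Metric.closedBall 0 1) ≤ ENNReal.ofReal (ε * r)

/-- The reproducing kernel integral
`∫_T (1 − |w|²) |u(ξ)|² / |1 − conj(w) φ(ξ)|² dm(ξ)`. -/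
def repKerInt (u φ : ℂ → ℂ) (w : ℂ) : ENNReal :=
  (ENNReal.ofReal (2 * Real.pi))⁻¹ *
    ∫⁻ θ in Set.Ioc (0:ℝ) (2 * Real.pi),
      ENNReal.ofReal ((1 - ‖w‖ ^ 2) * ‖bdryVal u (Complex.exp (θ * Complex.I))‖ ^ 2 /
        ‖1 - (starRingEnd ℂ) w * bdryVal φ (Complex.exp (θ * Complex.I))‖ ^ 2)


lemma taylor_hasSum {f : ℂ → ℂ} (hf : DifferentiableOn ℂ f unitDisk) {z : ℂ} (hz : z ∈ unitDisk) :
    HasSum (fun k => taylorCoeff f k * z ^ k) (f z) := by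
  have := Complex.hasSum_taylorSeries_on_ball hf hz
  have e : (fun k => taylorCoeff f k * z ^ k) =
      fun n : ℕ => ((n.factorial : ℂ))⁻¹ • (z - 0) ^ n • iteratedDeriv n f 0 := by
    funext k
    simp only [taylorCoeff, smul_eq_mul, sub_zero]
    ring
  rw [e]; exact this

lemma circ_mem {r : ℝ} (h0 : 0 ≤ r) (h1 : r < 1) (θ : ℝ) :
    (r : ℂ) * exp (θ * I) ∈ unitDisk := by
  simp [unitDisk, Complex.norm_exp_ofReal_mul_I, abs_of_nonneg h0, h1]

lemma taylor_summable {f : ℂ → ℂ} (hf : DifferentiableOn ℂ f unitDisk) {r : ℝ}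
    (h0 : 0 ≤ r) (h1 : r < 1) : Summable (fun k => ‖taylorCoeff f k‖ * r ^ k) := by
  have hz : (r : ℂ) ∈ unitDisk := by simp [unitDisk, abs_of_nonneg h0, h1]
  have := (taylor_hasSum hf hz).summable.norm
  convert this using 2 with k
  simp [abs_of_nonneg h0]

/-- Unnormalised integral mean. -/
def Mr (f : ℂ → ℂ) (r : ℝ) : ENNReal :=
  ∫⁻ θ in Ioc (0:ℝ) (2 * Real.pi), ‖f ((r : ℂ) * exp (θ * I))‖ₑ ^ 2

/-- Hardy energy. -/
def Hn (f : ℂ → ℂ) : ENNReal := ∑' k, ‖taylorCoeff f k‖ₑ ^ 2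

lemma cont_circ {f : ℂ → ℂ} (hf : DifferentiableOn ℂ f unitDisk) {r : ℝ}
    (h0 : 0 ≤ r) (h1 : r < 1) : Continuous (fun θ : ℝ => f ((r : ℂ) * exp (θ * I))) := by
  have : ContinuousOn f unitDisk := hf.continuousOn
  refine this.comp_continuous (by fun_prop) (fun θ => circ_mem h0 h1 θ)

lemma exp_int (n : ℤ) : ∫ x in (0:ℝ)..(2*Real.pi), exp ((n:ℂ) * x * I) =
    if n = 0 then 2 * Real.pi else 0 := by
  split_ifs with h
  · subst h; simp
  · have h1 : ((n:ℂ) * I) ≠ 0 := by simp [h]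
    have := integral_exp_mul_complex (a := 0) (b := 2 * Real.pi) h1
    have e : ∀ x : ℝ, (n:ℂ) * x * I = (n * I) * x := fun x => by ring
    simp_rw [e]
    rw [this]
    have : exp ((n:ℂ) * I * ((2 * Real.pi : ℝ) : ℂ)) = 1 := by
      rw [Complex.exp_eq_one_iff]; exact ⟨n, by push_cast; ring⟩
    rw [this]; simp

lemma fourier_circ {f : ℂ → ℂ} (hf : DifferentiableOn ℂ f unitDisk) {r : ℝ}
    (h0 : 0 ≤ r) (h1 : r < 1) (n : ℤ) :
    fourierCoeffOn (a := 0) (b := 2 * Real.pi) (by positivity)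
      (fun θ : ℝ => f ((r : ℂ) * exp (θ * I))) n =
    if 0 ≤ n then taylorCoeff f n.toNat * r ^ n.toNat else 0 := by
  rw [fourierCoeffOn_eq_integral]
  have key : HasSum (fun k : ℕ => ∫ x in (0:ℝ)..(2*Real.pi),
      exp (-(n:ℂ) * x * I) * (taylorCoeff f k * ((r:ℂ) * exp (x * I)) ^ k))
      (∫ x in (0:ℝ)..(2*Real.pi), exp (-(n:ℂ) * x * I) * f ((r:ℂ) * exp (x * I))) := by
    refine intervalIntegral.hasSum_integral_of_dominated_convergence
      (fun k _ => ‖taylorCoeff f k‖ * r ^ k) ?_ ?_ ?_ ?_ ?_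
    · intro k; exact Continuous.aestronglyMeasurable (by fun_prop)
    · intro k
      filter_upwards with x hx
      have : ‖exp (-(n:ℂ) * x * I)‖ = 1 := by
        have := Complex.norm_exp_ofReal_mul_I (-(n:ℝ) * x)
        push_cast at this; exact this
      simp [Complex.norm_exp_ofReal_mul_I, abs_of_nonneg h0] at this ⊢
      rw [this]; simp
    · filter_upwards with x hx using taylor_summable hf h0 h1
    · exact continuous_const.intervalIntegrable _ _
    · filter_upwards with x hx
      exact (taylor_hasSum hf (circ_mem h0 h1 x)).mul_left _
  have e1 : ∀ k : ℕ, (∫ x in (0:ℝ)..(2*Real.pi),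
      exp (-(n:ℂ) * x * I) * (taylorCoeff f k * ((r:ℂ) * exp (x * I)) ^ k)) =
      if n = k then 2 * Real.pi * (taylorCoeff f k * r ^ k) else 0 := by
    intro k
    have : ∀ x : ℝ, exp (-(n:ℂ) * x * I) * (taylorCoeff f k * ((r:ℂ) * exp (x * I)) ^ k) =
        (taylorCoeff f k * r ^ k) * exp (((k - n : ℤ):ℂ) * x * I) := by
      intro x
      have e2 : exp (((k - n : ℤ):ℂ) * x * I) = exp (-(n:ℂ) * x * I) * exp (x * I) ^ k := by
        rw [← Complex.exp_nat_mul, ← Complex.exp_add]; congr 1; push_cast; ring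
      rw [e2]; ring
    simp_rw [this]
    rw [intervalIntegral.integral_const_mul, exp_int]
    by_cases h : n = k
    · subst h; simp; ring
    · rw [if_neg h, if_neg (by omega)]; simp
  simp_rw [e1] at key
  have e3 : ∀ x : ℝ, (fourier (-n) (x : AddCircle (2 * Real.pi - 0)) : ℂ) =
      exp (-(n:ℂ) * x * I) := by
    intro x
    rw [fourier_coe_apply]
    congr 1
    have : (Real.pi : ℂ) ≠ 0 := by exact_mod_cast Real.pi_ne_zero
    push_cast; field_simp; simp; ring
  simp_rw [e3, smul_eq_mul]
  rw [← key.tsum_eq]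
  have pi0 : (Real.pi : ℂ) ≠ 0 := by exact_mod_cast Real.pi_ne_zero
  split_ifs with hn
  · rw [tsum_eq_single n.toNat]
    · rw [if_pos (by omega)]
      rw [Complex.real_smul]
      push_cast; field_simp; simp
    · intro k hk; rw [if_neg (by omega)]
  · have : ∀ k : ℕ, n ≠ k := by intro k; omega
    simp [this]

lemma parseval {f : ℂ → ℂ} (hf : DifferentiableOn ℂ f unitDisk) {r : ℝ}
    (h0 : 0 ≤ r) (h1 : r < 1) :
    Mr f r = ENNReal.ofReal (2 * Real.pi) *
      ∑' k, ‖taylorCoeff f k‖ₑ ^ 2 * ENNReal.ofReal r ^ (2 * k) := by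
  have hc := cont_circ hf h0 h1
  have pp : (0:ℝ) < 2 * Real.pi := by positivity
  have hmem : MemLp (fun θ : ℝ => f ((r : ℂ) * exp (θ * I))) 2
      (volume.restrict (Ioc 0 (2 * Real.pi))) := by
    obtain ⟨C, hC⟩ := (isCompact_Icc (a := (0:ℝ)) (b := 2 * Real.pi)).exists_bound_of_continuousOn
      hc.continuousOn
    refine MemLp.of_bound hc.aestronglyMeasurable C ?_
    filter_upwards [ae_restrict_mem measurableSet_Ioc] with x hx
    exact hC x (Ioc_subset_Icc_self hx)
  have H := hasSum_sq_fourierCoeffOn (a := 0) (b := 2 * Real.pi) (by positivity) hmem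
  have H2 : HasSum (fun k : ℕ => (‖taylorCoeff f k‖ * r ^ k) ^ 2)
      ((2 * Real.pi)⁻¹ * ∫ x in (0:ℝ)..(2*Real.pi), ‖f ((r : ℂ) * exp (x * I))‖ ^ 2) := by
    have inj : Function.Injective (fun k : ℕ => (k : ℤ)) := Nat.cast_injective
    rw [← inj.hasSum_iff] at H
    · convert H using 1
      · ext k
        simp only [Function.comp]
        rw [fourier_circ hf h0 h1]
        simp [abs_of_nonneg h0]
      · simp
    · intro n hn
      rw [fourier_circ hf h0 h1, if_neg]
      · simp
      · intro h; exact hn ⟨n.toNat, by simp [h]⟩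
  have H3 : Mr f r = ENNReal.ofReal (∫ x in (0:ℝ)..(2*Real.pi),
      ‖f ((r : ℂ) * exp (x * I))‖ ^ 2) := by
    rw [intervalIntegral.integral_of_le pp.le, ofReal_integral_eq_lintegral_ofReal]
    · simp only [Mr]
      congr 1; ext x
      rw [← ofReal_norm, ENNReal.ofReal_pow (norm_nonneg _)]
    · exact (((hc.norm.pow 2).integrableOn_Icc).mono_set Ioc_subset_Icc_self)
    · filter_upwards with x; positivity
  have H4 : (∑' k : ℕ, ‖taylorCoeff f k‖ₑ ^ 2 * ENNReal.ofReal r ^ (2 * k)) =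
      ENNReal.ofReal ((2 * Real.pi)⁻¹ * ∫ x in (0:ℝ)..(2*Real.pi),
        ‖f ((r : ℂ) * exp (x * I))‖ ^ 2) := by
    rw [← H2.tsum_eq, ENNReal.ofReal_tsum_of_nonneg (fun k => by positivity) H2.summable]
    congr 1; ext k
    rw [ENNReal.ofReal_pow (by positivity), ENNReal.ofReal_mul (by positivity),
      ENNReal.ofReal_pow h0, ofReal_norm, mul_pow, ← pow_mul, mul_comm k 2]
  rw [H4, H3, ← ENNReal.ofReal_mul pp.le]
  congr 1; rw [← mul_assoc, mul_inv_cancel₀ pp.ne', one_mul]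

lemma Mr_le_Hn {f : ℂ → ℂ} (hf : DifferentiableOn ℂ f unitDisk) {r : ℝ}
    (h0 : 0 ≤ r) (h1 : r < 1) : Mr f r ≤ ENNReal.ofReal (2 * Real.pi) * Hn f := by
  rw [parseval hf h0 h1, Hn]
  gcongr with k
  have : ENNReal.ofReal r ^ (2 * k) ≤ 1 := pow_le_one₀ (zero_le) (by simpa using h1.le)
  calc _ ≤ ‖taylorCoeff f k‖ₑ ^ 2 * 1 := by gcongr
    _ = _ := mul_one _

lemma Mr_mono {f : ℂ → ℂ} (hf : DifferentiableOn ℂ f unitDisk) {r s : ℝ}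
    (h0 : 0 ≤ r) (hrs : r ≤ s) (h1 : s < 1) : Mr f r ≤ Mr f s := by
  rw [parseval hf h0 (hrs.trans_lt h1), parseval hf (h0.trans hrs) h1]
  gcongr

lemma Hn_le {f : ℂ → ℂ} (hf : DifferentiableOn ℂ f unitDisk) {C : ENNReal}
    (h : ∀ r : ℝ, 0 ≤ r → r < 1 → Mr f r ≤ ENNReal.ofReal (2 * Real.pi) * C) : Hn f ≤ C := by
  have p0 : ENNReal.ofReal (2 * Real.pi) ≠ 0 := by
    simp only [ne_eq, ENNReal.ofReal_eq_zero, not_le]; positivity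
  rw [Hn, ENNReal.tsum_eq_iSup_sum]
  refine iSup_le fun s => ?_
  have hle : ∀ r : ℝ, 0 ≤ r → r < 1 →
      ∑ k ∈ s, ‖taylorCoeff f k‖ₑ ^ 2 * ENNReal.ofReal r ^ (2 * k) ≤ C := by
    intro r h0 h1
    have := h r h0 h1
    rw [parseval hf h0 h1, ENNReal.mul_le_mul_iff_right p0 ENNReal.ofReal_ne_top] at this
    exact (ENNReal.sum_le_tsum s).trans this
  have ht : Tendsto (fun r : ℝ => ∑ k ∈ s, ‖taylorCoeff f k‖ₑ ^ 2 * ENNReal.ofReal r ^ (2 * k))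
      (nhdsWithin 1 (Iio 1)) (nhds (∑ k ∈ s, ‖taylorCoeff f k‖ₑ ^ 2 * ENNReal.ofReal 1 ^ (2 * k))) := by
    refine tendsto_finsetSum _ fun k _ => ?_
    refine ENNReal.Tendsto.const_mul ?_ (Or.inr (by finiteness))
    refine ENNReal.Tendsto.pow ?_
    exact (ENNReal.continuous_ofReal.tendsto 1).mono_left nhdsWithin_le_nhds
  simp only [ENNReal.ofReal_one, one_pow, mul_one] at ht
  refine le_of_tendsto ht ?_
  have : Ioo (0:ℝ) 1 ∈ nhdsWithin (1:ℝ) (Iio 1) := Ioo_mem_nhdsLT (by norm_num)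
  filter_upwards [this] with r hr using hle r hr.1.le hr.2

lemma Hn_term (f : ℂ → ℂ) (k : ℕ) :
    ‖taylorCoeff f k‖ₑ ^ 2 = ENNReal.ofReal (‖taylorCoeff f k‖ ^ 2) := by
  rw [← ofReal_norm, ENNReal.ofReal_pow (norm_nonneg _)]

lemma memH2_iff {f : ℂ → ℂ} : MemH2 f ↔ DifferentiableOn ℂ f unitDisk ∧ Hn f < ⊤ := by
  simp only [MemH2, Hn, Hn_term]
  refine and_congr_right fun _ => ⟨fun h => ?_, fun h => ?_⟩
  · exact h.tsum_ofReal_lt_top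
  · have := ENNReal.summable_toReal h.ne
    convert this using 2 with k
    rw [ENNReal.toReal_ofReal (by positivity)]

lemma h2NormSq_eq (f : ℂ → ℂ) : h2NormSq f = (Hn f).toReal := by
  simp only [h2NormSq, Hn, Hn_term]
  rw [ENNReal.tsum_toReal_eq (fun k => ENNReal.ofReal_ne_top)]
  congr 1; ext k
  rw [ENNReal.toReal_ofReal (by positivity)]

lemma taylorCoeff_congr {f g : ℂ → ℂ} (h : EqOn f g unitDisk) (k : ℕ) :
    taylorCoeff f k = taylorCoeff g k := by
  have : f =ᶠ[nhds 0] g := by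
    filter_upwards [Metric.ball_mem_nhds (0:ℂ) one_pos] with z hz using h hz
  simp only [taylorCoeff, this.iteratedDeriv_eq k]

lemma Hn_congr {f g : ℂ → ℂ} (h : EqOn f g unitDisk) : Hn f = Hn g := by
  simp only [Hn, taylorCoeff_congr h]

lemma MemH2.congr {f g : ℂ → ℂ} (hf : MemH2 f) (h : EqOn f g unitDisk) : MemH2 g := by
  rw [memH2_iff] at *
  exact ⟨hf.1.congr fun z hz => (h hz).symm, Hn_congr h ▸ hf.2⟩

lemma enorm_sq (a : ℂ) : ‖a‖ₑ ^ 2 = ENNReal.ofReal (‖a‖ ^ 2) := by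
  rw [← ofReal_norm, ENNReal.ofReal_pow (norm_nonneg _)]

lemma Hn_comb {ι : Type*} (s : Finset ι) (w : ι → ENNReal) {f : ℂ → ℂ} {g : ι → ℂ → ℂ}
    (hf : DifferentiableOn ℂ f unitDisk) (hg : ∀ i ∈ s, DifferentiableOn ℂ (g i) unitDisk)
    (h : ∀ z ∈ unitDisk, ‖f z‖ₑ ^ 2 ≤ ∑ i ∈ s, w i * ‖g i z‖ₑ ^ 2) :
    Hn f ≤ ∑ i ∈ s, w i * Hn (g i) := by
  refine Hn_le hf fun r h0 h1 => ?_
  have hm : ∀ i ∈ s, Measurable (fun θ : ℝ => ‖g i ((r : ℂ) * exp (θ * I))‖ₑ ^ 2) :=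
    fun i hi => ((cont_circ (hg i hi) h0 h1).measurable.enorm).pow_const 2
  calc Mr f r ≤ ∫⁻ θ in Ioc (0:ℝ) (2 * Real.pi),
        ∑ i ∈ s, w i * ‖g i ((r : ℂ) * exp (θ * I))‖ₑ ^ 2 :=
        lintegral_mono fun θ => h _ (circ_mem h0 h1 θ)
    _ = ∑ i ∈ s, w i * Mr (g i) r := by
        rw [lintegral_finsetSum' _ fun i hi => ((hm i hi).const_mul _).aemeasurable]
        refine Finset.sum_congr rfl fun i hi => ?_
        rw [lintegral_const_mul _ (hm i hi), Mr]
    _ ≤ ∑ i ∈ s, w i * (ENNReal.ofReal (2 * Real.pi) * Hn (g i)) := by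
        gcongr with i hi
        exact Mr_le_Hn (hg i hi) h0 h1
    _ = _ := by
        rw [Finset.mul_sum]
        refine Finset.sum_congr rfl fun i hi => by ring

lemma Hn_mul_le {f h : ℂ → ℂ} {C : ℝ} (hf : DifferentiableOn ℂ f unitDisk)
    (hh : DifferentiableOn ℂ h unitDisk) (hC : ∀ z ∈ unitDisk, ‖h z‖ ≤ C) :
    Hn (fun z => h z * f z) ≤ ENNReal.ofReal (C ^ 2) * Hn f := by
  have := Hn_comb (ι := Unit) {()} (fun _ => ENNReal.ofReal (C ^ 2)) (f := fun z => h z * f z)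
    (g := fun _ => f) (hh.mul hf) (fun _ _ => hf) (fun z hz => by
      simp only [Finset.sum_singleton]
      rw [enorm_sq, enorm_sq, ← ENNReal.ofReal_mul (by positivity)]
      apply ENNReal.ofReal_le_ofReal
      rw [norm_mul, mul_pow]
      have := hC z hz
      gcongr)
  simpa using this

lemma sq_add_le {η : ℝ} (hη : 0 < η) (a b : ℂ) :
    ‖a + b‖ ^ 2 ≤ (1 + η⁻¹) * ‖a‖ ^ 2 + (1 + η) * ‖b‖ ^ 2 := by
  have h := norm_add_le a b
  have h1 : ‖a + b‖ ^ 2 ≤ (‖a‖ + ‖b‖) ^ 2 := by gcongr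
  have h2 : 2 * ‖a‖ * ‖b‖ ≤ η⁻¹ * ‖a‖ ^ 2 + η * ‖b‖ ^ 2 := by
    have : 0 ≤ η⁻¹ * (‖a‖ - η * ‖b‖) ^ 2 := by positivity
    have e : η⁻¹ * (‖a‖ - η * ‖b‖) ^ 2 = η⁻¹ * ‖a‖ ^ 2 + η * ‖b‖ ^ 2 - 2 * ‖a‖ * ‖b‖ := by
      field_simp; ring
    linarith
  nlinarith

lemma Hn_add_le {η : ℝ} (hη : 0 < η) {f g : ℂ → ℂ} (hf : DifferentiableOn ℂ f unitDisk)
    (hg : DifferentiableOn ℂ g unitDisk) :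
    Hn (fun z => f z + g z) ≤ ENNReal.ofReal (1 + η⁻¹) * Hn f + ENNReal.ofReal (1 + η) * Hn g := by
  have := Hn_comb (ι := Fin 2) Finset.univ
    ![ENNReal.ofReal (1 + η⁻¹), ENNReal.ofReal (1 + η)] (f := fun z => f z + g z)
    (g := ![f, g]) (hf.add hg) (fun i _ => by fin_cases i <;> simpa) (fun z hz => by
      simp only [Fin.sum_univ_two, Matrix.cons_val_zero, Matrix.cons_val_one]
      rw [enorm_sq, enorm_sq, enorm_sq, ← ENNReal.ofReal_mul (by positivity),
        ← ENNReal.ofReal_mul (by positivity), ← ENNReal.ofReal_add (by positivity) (by positivity)]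
      exact ENNReal.ofReal_le_ofReal (sq_add_le hη _ _))
  simpa [Fin.sum_univ_two] using this

lemma MemH2.diff {f : ℂ → ℂ} (hf : MemH2 f) : DifferentiableOn ℂ f unitDisk := hf.1

lemma MemH2.add {f g : ℂ → ℂ} (hf : MemH2 f) (hg : MemH2 g) : MemH2 (fun z => f z + g z) := by
  refine memH2_iff.2 ⟨hf.1.add hg.1, (Hn_add_le one_pos hf.1 hg.1).trans_lt ?_⟩
  have h1 := (memH2_iff.1 hf).2.ne
  have h2 := (memH2_iff.1 hg).2.ne
  finiteness

lemma MemH2.bdd_mul {f h : ℂ → ℂ} {C : ℝ} (hf : MemH2 f)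
    (hh : DifferentiableOn ℂ h unitDisk) (hC : ∀ z ∈ unitDisk, ‖h z‖ ≤ C) :
    MemH2 (fun z => h z * f z) := by
  refine memH2_iff.2 ⟨hh.mul hf.1, (Hn_mul_le hf.1 hh hC).trans_lt ?_⟩
  have h1 := (memH2_iff.1 hf).2.ne
  finiteness

lemma cs_pointwise {ι : Type*} (s : Finset ι) (c g : ι → ℂ) :
    ‖∑ i ∈ s, c i * g i‖ ^ 2 ≤ (∑ i ∈ s, ‖c i‖ ^ 2) * ∑ i ∈ s, ‖g i‖ ^ 2 := by
  have h1 : ‖∑ i ∈ s, c i * g i‖ ≤ ∑ i ∈ s, ‖c i‖ * ‖g i‖ :=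
    (norm_sum_le _ _).trans (by simp)
  calc _ ≤ (∑ i ∈ s, ‖c i‖ * ‖g i‖) ^ 2 := by gcongr
    _ ≤ _ := Finset.sum_mul_sq_le_sq_mul_sq _ _ _

lemma Hn_cs {ι : Type*} (s : Finset ι) (c : ι → ℂ) {g : ι → ℂ → ℂ}
    (hg : ∀ i ∈ s, DifferentiableOn ℂ (g i) unitDisk) :
    Hn (fun z => ∑ i ∈ s, c i * g i z) ≤
      ENNReal.ofReal (∑ i ∈ s, ‖c i‖ ^ 2) * ∑ i ∈ s, Hn (g i) := by
  rw [Finset.mul_sum]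
  refine Hn_comb s (fun _ => ENNReal.ofReal (∑ i ∈ s, ‖c i‖ ^ 2)) ?_ hg fun z hz => ?_
  · exact DifferentiableOn.fun_sum fun i hi => (hg i hi).const_mul _
  · rw [enorm_sq, ← Finset.mul_sum]
    simp_rw [enorm_sq]
    rw [← ENNReal.ofReal_sum_of_nonneg (fun i _ => by positivity), ← ENNReal.ofReal_mul
      (by positivity)]
    exact ENNReal.ofReal_le_ofReal (cs_pointwise s c _)

lemma Hn_lim {G : ℂ → ℂ} {S : ℕ → ℂ → ℂ} {C : ENNReal} (hG : DifferentiableOn ℂ G unitDisk)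
    (hS : ∀ K, DifferentiableOn ℂ (S K) unitDisk) (hC : ∀ K, Hn (S K) ≤ C)
    (hlim : ∀ z ∈ unitDisk, Tendsto (fun K => S K z) atTop (nhds (G z))) : Hn G ≤ C := by
  refine Hn_le hG fun r h0 h1 => ?_
  have hm : ∀ K, Measurable (fun θ : ℝ => ‖S K ((r : ℂ) * exp (θ * I))‖ₑ ^ 2) :=
    fun K => ((cont_circ (hS K) h0 h1).measurable.enorm).pow_const 2
  have e : ∀ θ : ℝ, ‖G ((r : ℂ) * exp (θ * I))‖ₑ ^ 2 =
      liminf (fun K => ‖S K ((r : ℂ) * exp (θ * I))‖ₑ ^ 2) atTop := by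
    intro θ
    refine (Tendsto.liminf_eq ?_).symm
    exact ENNReal.Tendsto.pow ((hlim _ (circ_mem h0 h1 θ)).enorm)
  rw [Mr]
  simp_rw [e]
  refine (lintegral_liminf_le hm).trans ?_
  refine liminf_le_of_frequently_le' (Frequently.of_forall fun K => ?_)
  exact (Mr_le_Hn (hS K) h0 h1).trans (by gcongr; exact hC K)

lemma growth {f : ℂ → ℂ} (hf : MemH2 f) {z : ℂ} (hz : z ∈ unitDisk) :
    ‖f z‖ ^ 2 * (1 - ‖z‖ ^ 2) ≤ h2NormSq f := by
  have hz1 : ‖z‖ < 1 := by simpa [unitDisk] using hz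
  have hz2 : ‖z‖ ^ 2 < 1 := by nlinarith [norm_nonneg z]
  have hs := (taylor_hasSum hf.1 hz).tendsto_sum_nat
  have hs2 := (hs.norm.pow 2)
  have : ‖f z‖ ^ 2 ≤ h2NormSq f * (1 - ‖z‖ ^ 2)⁻¹ := by
    refine le_of_tendsto hs2 (Eventually.of_forall fun n => ?_)
    refine (cs_pointwise _ _ _).trans ?_
    have h1 : ∑ i ∈ Finset.range n, ‖taylorCoeff f i‖ ^ 2 ≤ h2NormSq f :=
      hf.2.sum_le_tsum _ fun i _ => by positivity
    have h2 : ∑ i ∈ Finset.range n, ‖z ^ i‖ ^ 2 ≤ (1 - ‖z‖ ^ 2)⁻¹ := by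
      have e : ∀ i, ‖z ^ i‖ ^ 2 = (‖z‖ ^ 2) ^ i := fun i => by rw [norm_pow]; ring
      simp_rw [e]
      rw [← tsum_geometric_of_lt_one (by positivity) hz2]
      exact (summable_geometric_of_lt_one (by positivity) hz2).sum_le_tsum _
        fun i _ => by positivity
    have h3 : 0 ≤ h2NormSq f := tsum_nonneg fun i => by positivity
    gcongr
  have h5 : 0 < 1 - ‖z‖ ^ 2 := by linarith
  calc _ ≤ h2NormSq f * (1 - ‖z‖ ^ 2)⁻¹ * (1 - ‖z‖ ^ 2) := by gcongr
    _ = _ := by field_simp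

lemma poly_bdd (p : Polynomial ℂ) : ∃ C : ℝ, ∀ z ∈ unitDisk, ‖p.eval z‖ ≤ C := by
  obtain ⟨C, hC⟩ := (isCompact_closedBall (0:ℂ) 1).exists_bound_of_continuousOn
    p.continuous.continuousOn
  exact ⟨C, fun z hz => hC z (Metric.ball_subset_closedBall hz)⟩

lemma taylorCoeff_poly (p : Polynomial ℂ) (k : ℕ) :
    taylorCoeff (fun z => p.eval z) k = p.coeff k := by
  have h : ∀ (k : ℕ) (p : Polynomial ℂ), iteratedDeriv k (fun z => p.eval z) =
      fun z => (Polynomial.derivative^[k] p).eval z := by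
    intro k
    induction k with
    | zero => intro p; simp
    | succ n ih =>
      intro p
      rw [iteratedDeriv_succ', Function.iterate_succ, Function.comp, ← ih]
      congr 1; funext z; simp
  rw [taylorCoeff, h]
  simp only
  rw [← Polynomial.coeff_zero_eq_eval_zero, Polynomial.coeff_iterate_derivative]
  have h0 : (k.factorial : ℂ) ≠ 0 := by exact_mod_cast k.factorial_ne_zero
  simp only [zero_add, Nat.descFactorial_self, nsmul_eq_mul]
  exact mul_div_cancel_left₀ _ h0

lemma taylorCoeff_le_Hn (f : ℂ → ℂ) (k : ℕ) : ‖taylorCoeff f k‖ₑ ^ 2 ≤ Hn f :=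
  ENNReal.le_tsum k

lemma memH2_poly (p : Polynomial ℂ) : MemH2 (fun z => p.eval z) := by
  refine ⟨p.differentiable.differentiableOn, ?_⟩
  refine summable_of_ne_finset_zero (s := p.support) fun k hk => ?_
  rw [taylorCoeff_poly, Polynomial.notMem_support_iff.1 hk]; simp

lemma memH2_const (c : ℂ) : MemH2 (fun _ => c) := by
  simpa using memH2_poly (Polynomial.C c)

lemma h2NormSq_nonneg (f : ℂ → ℂ) : 0 ≤ h2NormSq f := tsum_nonneg fun _ => by positivity

lemma h2NormSq_add_le {η : ℝ} (hη : 0 < η) {f g : ℂ → ℂ} (hf : MemH2 f) (hg : MemH2 g) :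
    h2NormSq (fun z => f z + g z) ≤ (1 + η⁻¹) * h2NormSq f + (1 + η) * h2NormSq g := by
  have h := Hn_add_le hη hf.1 hg.1
  have h1 := (memH2_iff.1 hf).2.ne
  have h2 := (memH2_iff.1 hg).2.ne
  have := ENNReal.toReal_mono (by finiteness) h
  rw [ENNReal.toReal_add (by finiteness) (by finiteness), ENNReal.toReal_mul,
    ENNReal.toReal_mul, ENNReal.toReal_ofReal (by positivity),
    ENNReal.toReal_ofReal (by positivity)] at this
  simpa only [h2NormSq_eq] using this

lemma MemH2.const_mul {f : ℂ → ℂ} (c : ℂ) (hf : MemH2 f) : MemH2 (fun z => c * f z) :=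
  hf.bdd_mul (h := fun _ => c) (C := ‖c‖) (differentiableOn_const _) (fun _ _ => le_rfl)

lemma h2NormSq_const_mul_le {f : ℂ → ℂ} (c : ℂ) (hf : MemH2 f) :
    h2NormSq (fun z => c * f z) ≤ ‖c‖ ^ 2 * h2NormSq f := by
  have h := Hn_mul_le (h := fun _ => c) (C := ‖c‖) hf.1 (differentiableOn_const _)
    (fun _ _ => le_rfl)
  have h1 := (memH2_iff.1 hf).2.ne
  have := ENNReal.toReal_mono (by finiteness) h
  rw [ENNReal.toReal_mul, ENNReal.toReal_ofReal (by positivity)] at this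
  simpa only [h2NormSq_eq] using this

lemma h2NormSq_congr {f g : ℂ → ℂ} (h : EqOn f g unitDisk) : h2NormSq f = h2NormSq g := by
  rw [h2NormSq_eq, h2NormSq_eq, Hn_congr h]

lemma ofReal_h2NormSq {f : ℂ → ℂ} (hf : MemH2 f) : ENNReal.ofReal (h2NormSq f) = Hn f := by
  rw [h2NormSq_eq, ENNReal.ofReal_toReal (memH2_iff.1 hf).2.ne]

/-- `a₁` as a polynomial. -/
def a1p {n : ℕ} (ξ : Fin n → ℂ) (m : Fin n → ℕ) : Polynomial ℂ :=
  ∏ j, (Polynomial.X - Polynomial.C (ξ j)) ^ (m j)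

lemma a1p_eval {n : ℕ} (ξ : Fin n → ℂ) (m : Fin n → ℕ) (z : ℂ) :
    (a1p ξ m).eval z = a1fun ξ m z := by
  simp [a1p, a1fun, Polynomial.eval_prod]

lemma a1p_monic {n : ℕ} (ξ : Fin n → ℂ) (m : Fin n → ℕ) : (a1p ξ m).Monic :=
  Polynomial.monic_prod_of_monic _ _ fun _ _ => (Polynomial.monic_X_sub_C _).pow _

lemma a1p_degree {n : ℕ} (ξ : Fin n → ℂ) (m : Fin n → ℕ) :
    (a1p ξ m).degree = ((∑ j, m j : ℕ) : WithBot ℕ) := by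
  rw [a1p, Polynomial.degree_prod]
  simp [Polynomial.degree_pow, Polynomial.degree_X_sub_C]

lemma a1fun_ne {n : ℕ} {ξ : Fin n → ℂ} {m : Fin n → ℕ} (hξ : ∀ j, ξ j ∈ unitCircle)
    {z : ℂ} (hz : z ∈ unitDisk) : a1fun ξ m z ≠ 0 := by
  rw [a1fun, Finset.prod_ne_zero_iff]
  intro j _
  apply pow_ne_zero
  intro h
  rw [sub_eq_zero] at h
  have := hξ j
  rw [← h] at this
  simp [unitDisk, unitCircle] at this hz
  linarith

lemma rad_mem {ζ : ℂ} (hζ : ζ ∈ unitCircle) {r : ℝ} (h0 : 0 < r) (h1 : r < 1) :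
    (r : ℂ) * ζ ∈ unitDisk := by
  simp [unitDisk, unitCircle] at *
  rw [hζ, abs_of_pos h0]; linarith

lemma Ioo_ev : ∀ᶠ r : ℝ in nhdsWithin 1 (Iio 1), 0 < r ∧ r < 1 :=
  Ioo_mem_nhdsLT (by norm_num)

lemma rad_tendsto (ζ : ℂ) : Tendsto (fun r : ℝ => (r : ℂ) * ζ) (nhdsWithin 1 (Iio 1)) (nhds ζ) := by
  have : Tendsto (fun r : ℝ => (r : ℂ) * ζ) (nhds 1) (nhds (((1:ℝ) : ℂ) * ζ)) :=
    Continuous.tendsto (by fun_prop) 1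
  simpa using this.mono_left nhdsWithin_le_nhds

lemma rad_lim {g : ℂ → ℂ} (hg : MemH2 g) {ζ : ℂ} (hζ : ζ ∈ unitCircle) :
    Tendsto (fun r : ℝ => ((r : ℂ) * ζ - ζ) * g (r * ζ)) (nhdsWithin 1 (Iio 1)) (nhds 0) := by
  rw [tendsto_zero_iff_norm_tendsto_zero]
  have hz : ‖ζ‖ = 1 := by simpa [unitCircle] using hζ
  have h1 : Tendsto (fun r : ℝ => Real.sqrt ((1 - r) * h2NormSq g)) (nhdsWithin 1 (Iio 1))
      (nhds 0) := by
    have : Tendsto (fun r : ℝ => Real.sqrt ((1 - r) * h2NormSq g)) (nhds 1)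
      (nhds (Real.sqrt ((1 - 1) * h2NormSq g))) := Continuous.tendsto (by fun_prop) 1
    simpa using this.mono_left nhdsWithin_le_nhds
  refine squeeze_zero' (Eventually.of_forall fun _ => norm_nonneg _) ?_ h1
  filter_upwards [Ioo_ev] with r hr
  apply Real.le_sqrt_of_sq_le
  have hgr := growth hg (rad_mem hζ hr.1 hr.2)
  rw [norm_mul (r : ℂ), hz, mul_one, Complex.norm_real, Real.norm_of_nonneg hr.1.le] at hgr
  have e : (r : ℂ) * ζ - ζ = ((r - 1 : ℝ) : ℂ) * ζ := by push_cast; ring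
  rw [e, norm_mul, norm_mul, hz, Complex.norm_real, Real.norm_eq_abs, mul_one, mul_pow, sq_abs]
  have h3 : 0 ≤ ‖g (r * ζ)‖ ^ 2 := by positivity
  have h4 : 0 < 1 - r := by linarith [hr.2]
  calc (r - 1) ^ 2 * ‖g (r * ζ)‖ ^ 2 = (1 - r) * (‖g (r * ζ)‖ ^ 2 * (1 - r)) := by ring
    _ ≤ (1 - r) * (‖g (r * ζ)‖ ^ 2 * (1 - r ^ 2)) := by
        gcongr; nlinarith [hr.1]
    _ ≤ _ := by gcongr

lemma a1p_dvd_of_eq {n : ℕ} {ξ : Fin n → ℂ} {m : Fin n → ℕ} (hξ : ∀ j, ξ j ∈ unitCircle)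
    (hinj : Function.Injective ξ) {h : ℂ → ℂ} (hh : MemH2 h) {q : Polynomial ℂ}
    (he : ∀ z ∈ unitDisk, a1fun ξ m z * h z = q.eval z) : a1p ξ m ∣ q := by
  refine Finset.prod_dvd_of_coprime ?_ ?_
  · intro i _ j _ hij
    apply IsCoprime.pow
    exact Polynomial.pairwise_coprime_X_sub_C hinj hij
  · intro j _
    by_cases hq : q = 0
    · subst hq; exact dvd_zero _
    obtain ⟨q', hq', hnd⟩ := Polynomial.exists_eq_pow_rootMultiplicity_mul_and_not_dvd q hq (ξ j)
    set d := Polynomial.rootMultiplicity (ξ j) q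
    by_cases hd : m j ≤ d
    · rw [hq']; exact (pow_dvd_pow _ hd).mul_right _
    exfalso
    push Not at hd
    rw [Polynomial.dvd_iff_isRoot, Polynomial.IsRoot] at hnd
    apply hnd
    obtain ⟨A, hA⟩ : (Polynomial.X - Polynomial.C (ξ j)) ^ (m j) ∣ a1p ξ m :=
      Finset.dvd_prod_of_mem _ (Finset.mem_univ j)
    have key : ∀ z ∈ unitDisk, q'.eval z =
        ((z - ξ j) * h z) * ((z - ξ j) ^ (m j - d - 1) * A.eval z) := by
      intro z hz
      have hne : z - ξ j ≠ 0 := by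
        intro h0
        rw [sub_eq_zero] at h0
        have := hξ j
        rw [← h0] at this
        simp [unitDisk, unitCircle] at this hz
        linarith
      have h1 := he z hz
      rw [← a1p_eval, hA, hq'] at h1
      simp only [Polynomial.eval_mul, Polynomial.eval_pow, Polynomial.eval_sub, Polynomial.eval_X,
        Polynomial.eval_C] at h1
      have e : m j = d + 1 + (m j - d - 1) := by omega
      rw [e, pow_add, pow_add] at h1
      apply mul_left_cancel₀ (pow_ne_zero d hne)
      rw [← h1]; ring
    have t1 : Tendsto (fun r : ℝ => q'.eval ((r : ℂ) * ξ j)) (nhdsWithin 1 (Iio 1))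
        (nhds (q'.eval (ξ j))) := (q'.continuous.tendsto _).comp (rad_tendsto (ξ j))
    have t2 : Tendsto (fun r : ℝ => q'.eval ((r : ℂ) * ξ j)) (nhdsWithin 1 (Iio 1)) (nhds 0) := by
      have c2 : Continuous (fun z : ℂ => (z - ξ j) ^ (m j - d - 1) * A.eval z) := by fun_prop
      have t3 := (rad_lim hh (hξ j)).mul ((c2.tendsto _).comp (rad_tendsto (ξ j)))
      rw [zero_mul] at t3
      refine t3.congr' ?_
      filter_upwards [Ioo_ev] with r hr
      exact (key _ (rad_mem (hξ j) hr.1 hr.2)).symm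
    exact tendsto_nhds_unique t1 t2

lemma decomp_unique {n : ℕ} {ξ : Fin n → ℂ} {m : Fin n → ℕ} (hξ : ∀ j, ξ j ∈ unitCircle)
    (hinj : Function.Injective ξ) {f g g' : ℂ → ℂ} {q q' : Polynomial ℂ}
    (h : HbDecompOf ξ m f g q) (h' : HbDecompOf ξ m f g' q') : q = q' ∧ EqOn g g' unitDisk := by
  have hq : q' - q = 0 := by
    have : a1p ξ m ∣ q' - q := by
      refine a1p_dvd_of_eq hξ hinj (h.1.add (h'.1.const_mul (-1))) fun z hz => ?_
      have h1 := h.2.2 z hz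
      have h2 := h'.2.2 z hz
      rw [Polynomial.eval_sub]
      linear_combination h2 - h1
    refine Polynomial.eq_zero_of_dvd_of_degree_lt this ?_
    rw [a1p_degree]
    exact (Polynomial.degree_sub_le _ _).trans_lt (max_lt h'.2.1 h.2.1)
  have hq2 : q = q' := (sub_eq_zero.1 hq).symm
  refine ⟨hq2, fun z hz => ?_⟩
  have h1 := h.2.2 z hz
  have h2 := h'.2.2 z hz
  rw [hq2] at h1
  apply mul_left_cancel₀ (a1fun_ne (m := m) hξ hz)
  linear_combination h2 - h1

lemma hbDecomp_spec {n : ℕ} {ξ : Fin n → ℂ} {m : Fin n → ℕ} {f : ℂ → ℂ} (h : MemHb ξ m f) :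
    HbDecompOf ξ m f (hbDecomp ξ m f).1 (hbDecomp ξ m f).2 := by
  rw [hbDecomp, dif_pos h]; exact h.choose_spec

lemma hbNormSq_eq {n : ℕ} {ξ : Fin n → ℂ} {m : Fin n → ℕ} (hξ : ∀ j, ξ j ∈ unitCircle)
    (hinj : Function.Injective ξ) {f g : ℂ → ℂ} {q : Polynomial ℂ}
    (h : HbDecompOf ξ m f g q) :
    hbNormSq ξ m f = h2NormSq g + h2NormSq (fun z => q.eval z) := by
  have := decomp_unique hξ hinj (hbDecomp_spec ⟨(g, q), h⟩) h
  rw [hbNormSq, this.1, h2NormSq_congr this.2]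

lemma HbDecompOf.congr {n : ℕ} {ξ : Fin n → ℂ} {m : Fin n → ℕ} {f f' g : ℂ → ℂ}
    {q : Polynomial ℂ} (h : HbDecompOf ξ m f g q) (he : EqOn f f' unitDisk) :
    HbDecompOf ξ m f' g q :=
  ⟨h.1, h.2.1, fun z hz => by rw [← he hz, h.2.2 z hz]⟩

lemma HbDecompOf.add {n : ℕ} {ξ : Fin n → ℂ} {m : Fin n → ℕ} {f f' g g' : ℂ → ℂ}
    {q q' : Polynomial ℂ} (h : HbDecompOf ξ m f g q) (h' : HbDecompOf ξ m f' g' q') :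
    HbDecompOf ξ m (fun z => f z + f' z) (fun z => g z + g' z) (q + q') :=
  ⟨h.1.add h'.1, (Polynomial.degree_add_le _ _).trans_lt (max_lt h.2.1 h'.2.1), fun z hz => by
    beta_reduce
    rw [h.2.2 z hz, h'.2.2 z hz, Polynomial.eval_add]; ring⟩

lemma HbDecompOf.const_mul {n : ℕ} {ξ : Fin n → ℂ} {m : Fin n → ℕ} {f g : ℂ → ℂ}
    {q : Polynomial ℂ} (c : ℂ) (h : HbDecompOf ξ m f g q) :
    HbDecompOf ξ m (fun z => c * f z) (fun z => c * g z) (Polynomial.C c * q) :=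
  ⟨h.1.const_mul c, (by
    rw [← Polynomial.smul_eq_C_mul]
    exact (Polynomial.degree_smul_le _ _).trans_lt h.2.1), fun z hz => by
    beta_reduce
    rw [h.2.2 z hz, Polynomial.eval_mul, Polynomial.eval_C]; ring⟩

lemma hbNormSq_add_le {n : ℕ} {ξ : Fin n → ℂ} {m : Fin n → ℕ} (hξ : ∀ j, ξ j ∈ unitCircle)
    (hinj : Function.Injective ξ) {η : ℝ} (hη : 0 < η) {f f' : ℂ → ℂ}
    (h : MemHb ξ m f) (h' : MemHb ξ m f') :
    hbNormSq ξ m (fun z => f z + f' z) ≤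
      (1 + η⁻¹) * hbNormSq ξ m f + (1 + η) * hbNormSq ξ m f' := by
  obtain ⟨⟨g, q⟩, h⟩ := h
  obtain ⟨⟨g', q'⟩, h'⟩ := h'
  simp only at h h'
  rw [hbNormSq_eq hξ hinj h, hbNormSq_eq hξ hinj h', hbNormSq_eq hξ hinj (h.add h')]
  have h1 := h2NormSq_add_le hη h.1 h'.1
  have h2 := h2NormSq_add_le hη (memH2_poly q) (memH2_poly q')
  simp only [Polynomial.eval_add]
  linarith

lemma hbNormSq_const_mul_le {n : ℕ} {ξ : Fin n → ℂ} {m : Fin n → ℕ} (hξ : ∀ j, ξ j ∈ unitCircle)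
    (hinj : Function.Injective ξ) (c : ℂ) {f : ℂ → ℂ} (h : MemHb ξ m f) :
    hbNormSq ξ m (fun z => c * f z) ≤ ‖c‖ ^ 2 * hbNormSq ξ m f := by
  obtain ⟨⟨g, q⟩, h⟩ := h
  simp only at h
  rw [hbNormSq_eq hξ hinj h, hbNormSq_eq hξ hinj (h.const_mul c)]
  have h1 := h2NormSq_const_mul_le c h.1
  have h2 := h2NormSq_const_mul_le c (memH2_poly q)
  simp only [Polynomial.eval_mul, Polynomial.eval_C]
  linarith

lemma hbNormSq_nonneg {n : ℕ} (ξ : Fin n → ℂ) (m : Fin n → ℕ) (f : ℂ → ℂ) :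
    0 ≤ hbNormSq ξ m f := add_nonneg (h2NormSq_nonneg _) (h2NormSq_nonneg _)

lemma MemHb.congr {n : ℕ} {ξ : Fin n → ℂ} {m : Fin n → ℕ} {f f' : ℂ → ℂ}
    (h : MemHb ξ m f) (he : EqOn f f' unitDisk) : MemHb ξ m f' := by
  obtain ⟨gq, h⟩ := h
  exact ⟨gq, h.congr he⟩

/-- Polynomials in `φ`. -/
lemma poly_phi {n : ℕ} {ξ : Fin n → ℂ} {m : Fin n → ℕ} {φ g : ℂ → ℂ} {P : Polynomial ℂ}
    (hφ : MemBallHinf φ) (hd : HbDecompOf ξ m φ g P) (c : Polynomial ℂ) :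
    ∃ G, MemH2 G ∧ ∀ z ∈ unitDisk, c.eval (φ z) = a1fun ξ m z * G z + (c.comp P).eval z := by
  induction c using Polynomial.induction_on with
  | C a => exact ⟨fun _ => 0, memH2_const 0, fun z hz => by simp⟩
  | add p q hp hq =>
    obtain ⟨G, hG, hG'⟩ := hp
    obtain ⟨H, hH, hH'⟩ := hq
    refine ⟨_, hG.add hH, fun z hz => ?_⟩
    rw [Polynomial.eval_add, hG' z hz, hH' z hz, Polynomial.add_comp, Polynomial.eval_add]; ring
  | monomial k a h =>
    obtain ⟨G, hG, hG'⟩ := h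
    set c := Polynomial.C a * Polynomial.X ^ k
    obtain ⟨C, hC⟩ := poly_bdd (c.comp P)
    refine ⟨_, (hG.bdd_mul hφ.1 hφ.2).add (hd.1.bdd_mul
      (c.comp P).differentiable.differentiableOn hC), fun z hz => ?_⟩
    have e : Polynomial.C a * Polynomial.X ^ (k + 1) = c * Polynomial.X := by
      simp only [c]; ring
    have e2 : ((c * Polynomial.X).comp P) = c.comp P * P := by
      rw [Polynomial.mul_comp, Polynomial.X_comp]
    rw [e, Polynomial.eval_mul, Polynomial.eval_X, hG' z hz, e2, Polynomial.eval_mul]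
    have := hd.2.2 z hz
    linear_combination (c.comp P).eval z * this

lemma decomp_phi {n : ℕ} {ξ : Fin n → ℂ} {m : Fin n → ℕ} {φ g : ℂ → ℂ} {P : Polynomial ℂ}
    (hφ : MemBallHinf φ) (hd : HbDecompOf ξ m φ g P) (c : Polynomial ℂ) :
    ∃ G, HbDecompOf ξ m (fun z => c.eval (φ z)) G ((c.comp P) %ₘ a1p ξ m) := by
  obtain ⟨G, hG, hG'⟩ := poly_phi hφ hd c
  refine ⟨_, hG.add (memH2_poly ((c.comp P) /ₘ a1p ξ m)), ?_, fun z hz => ?_⟩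
  · rw [← a1p_degree ξ m]; exact Polynomial.degree_modByMonic_lt _ (a1p_monic ξ m)
  · simp only
    rw [hG' z hz]
    nth_rewrite 1 [← Polynomial.modByMonic_add_div (c.comp P) (a1p ξ m)]
    rw [Polynomial.eval_add, Polynomial.eval_mul, a1p_eval]; ring

lemma P_eval {n : ℕ} {ξ : Fin n → ℂ} {m : Fin n → ℕ} (hξ : ∀ j, ξ j ∈ unitCircle)
    (hm : ∀ j, 0 < m j) {φ g : ℂ → ℂ} {P : Polynomial ℂ} (hd : HbDecompOf ξ m φ g P)
    {Λ : Fin n → ℂ} (hΛ : ∀ j, NTLimit φ (ξ j) (Λ j)) (j : Fin n) : P.eval (ξ j) = Λ j := by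
  have hz : ‖ξ j‖ = 1 := by simpa [unitCircle] using hξ j
  have t1 : Tendsto (fun r : ℝ => φ ((r : ℂ) * ξ j)) (nhdsWithin 1 (Iio 1)) (nhds (Λ j)) := by
    refine (hΛ j 2 (by norm_num)).comp ?_
    refine tendsto_nhdsWithin_iff.2 ⟨rad_tendsto _, ?_⟩
    filter_upwards [Ioo_ev] with r hr
    refine ⟨rad_mem (hξ j) hr.1 hr.2, ?_⟩
    have e : (r : ℂ) * ξ j - ξ j = ((r - 1 : ℝ) : ℂ) * ξ j := by push_cast; ring
    rw [e, norm_mul, norm_mul, hz, Complex.norm_real, Complex.norm_real, Real.norm_eq_abs,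
      Real.norm_eq_abs, abs_of_pos hr.1, abs_of_neg (by linarith [hr.2])]
    linarith [hr.2]
  obtain ⟨A, hA⟩ : (Polynomial.X - Polynomial.C (ξ j)) ^ (m j) ∣ a1p ξ m :=
    Finset.dvd_prod_of_mem _ (Finset.mem_univ j)
  have c2 : Continuous (fun z : ℂ => (z - ξ j) ^ (m j - 1) * A.eval z) := by fun_prop
  have t3 := (rad_lim hd.1 (hξ j)).mul ((c2.tendsto _).comp (rad_tendsto (ξ j)))
  have t4 := t3.add ((P.continuous.tendsto _).comp (rad_tendsto (ξ j)))
  rw [zero_mul, zero_add] at t4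
  refine (tendsto_nhds_unique t1 (t4.congr' ?_)).symm
  filter_upwards [Ioo_ev] with r hr
  rw [hd.2.2 _ (rad_mem (hξ j) hr.1 hr.2), ← a1p_eval, hA]
  simp only [Polynomial.eval_mul, Polynomial.eval_pow, Polynomial.eval_sub, Polynomial.eval_X,
        Polynomial.eval_C, Function.comp]
  have e : m j = 1 + (m j - 1) := by have := hm j; omega
  nth_rewrite 2 [e]
  rw [pow_add]; ring

lemma summ_abs {x y : ℕ → ℝ} {A ρ : ℝ} (hx : ∀ k, 0 ≤ x k) (hy : ∀ k, 0 ≤ y k)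
    (hA : 0 ≤ A) (h1 : ρ < 1) (hs : Summable y)
    (h : ∀ k, x (k + 1) ≤ A * y k + ρ * x k) : Summable x := by
  have key : ∀ n, ∑ i ∈ Finset.range n, x i ≤ (x 0 + A * ∑' k, y k) / (1 - ρ) := by
    intro n
    have h2 : ∑ i ∈ Finset.range (n + 1), x i ≤
        x 0 + A * ∑' k, y k + ρ * ∑ i ∈ Finset.range n, x i := by
      rw [Finset.sum_range_succ']
      have : ∑ i ∈ Finset.range n, x (i + 1) ≤
          ∑ i ∈ Finset.range n, (A * y i + ρ * x i) := Finset.sum_le_sum fun i _ => h i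
      rw [Finset.sum_add_distrib, ← Finset.mul_sum, ← Finset.mul_sum] at this
      have h3 : ∑ i ∈ Finset.range n, y i ≤ ∑' k, y k := hs.sum_le_tsum _ fun i _ => hy i
      have := mul_le_mul_of_nonneg_left h3 hA
      linarith
    rw [Finset.sum_range_succ] at h2
    rw [le_div_iff₀ (by linarith)]
    have := hx n
    linarith
  exact summable_of_sum_range_le hx key

/-- Squared norm of a polynomial in `φ`. -/
def nb {n : ℕ} (ξ : Fin n → ℂ) (m : Fin n → ℕ) (φ : ℂ → ℂ) (c : Polynomial ℂ) : ℝ :=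
  hbNormSq ξ m (fun z => c.eval (φ z))

section
variable {n : ℕ} {ξ : Fin n → ℂ} {m : Fin n → ℕ} {φ g : ℂ → ℂ} {P : Polynomial ℂ}

lemma mem_phi (hφ : MemBallHinf φ) (hd : HbDecompOf ξ m φ g P) (c : Polynomial ℂ) :
    MemHb ξ m (fun z => c.eval (φ z)) := by
  obtain ⟨G, hG⟩ := decomp_phi hφ hd c
  exact ⟨(G, _), hG⟩

lemma nb_nonneg (c : Polynomial ℂ) : 0 ≤ nb ξ m φ c := hbNormSq_nonneg _ _ _

lemma nb_comb (hξ : ∀ j, ξ j ∈ unitCircle) (hinj : Function.Injective ξ)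
    (hφ : MemBallHinf φ) (hd : HbDecompOf ξ m φ g P) {η : ℝ} (hη : 0 < η)
    (c d e : Polynomial ℂ) (l : ℂ) (he : e = c + Polynomial.C l * d) :
    nb ξ m φ e ≤ (1 + η⁻¹) * nb ξ m φ c + (1 + η) * (‖l‖ ^ 2 * nb ξ m φ d) := by
  have h1 := hbNormSq_add_le hξ hinj hη (mem_phi hφ hd c) (mem_phi hφ hd (Polynomial.C l * d))
  have h2 := hbNormSq_const_mul_le hξ hinj l (mem_phi hφ hd d)
  subst he
  simp only [nb, Polynomial.eval_add, Polynomial.eval_mul, Polynomial.eval_C] at h1 h2 ⊢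
  have := mul_le_mul_of_nonneg_left h2 (by linarith : (0:ℝ) ≤ 1 + η)
  linarith

lemma nb_step (hξ : ∀ j, ξ j ∈ unitCircle) (hinj : Function.Injective ξ)
    (hφ : MemBallHinf φ) (hd : HbDecompOf ξ m φ g P) (c : Polynomial ℂ) {l : ℂ} (hl : ‖l‖ < 1) :
    (Summable fun k => nb ξ m φ (c * (Polynomial.X - Polynomial.C l) * Polynomial.X ^ k)) ↔
      Summable fun k => nb ξ m φ (c * Polynomial.X ^ k) := by
  constructor
  · intro h
    have hl2 : ‖l‖ ^ 2 < 1 := by nlinarith [norm_nonneg l]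
    obtain ⟨η, hη, hη2⟩ : ∃ η : ℝ, 0 < η ∧ (1 + η) * ‖l‖ ^ 2 < 1 := by
      refine ⟨(1 - ‖l‖ ^ 2) / 2, by linarith, ?_⟩
      nlinarith [sq_nonneg ‖l‖]
    refine summ_abs (A := 1 + η⁻¹) (fun _ => nb_nonneg _) (fun _ => nb_nonneg _) (by positivity)
      hη2 h fun k => ?_
    have := nb_comb hξ hinj hφ hd hη (c * (Polynomial.X - Polynomial.C l) * Polynomial.X ^ k)
      (c * Polynomial.X ^ k) (c * Polynomial.X ^ (k + 1)) l (by ring)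
    linarith
  · intro h
    refine Summable.of_nonneg_of_le (fun _ => nb_nonneg _) (fun k => ?_)
      ((((summable_nat_add_iff 1).2 h).mul_left (1 + 1⁻¹)).add (h.mul_left ((1 + 1) * ‖-l‖ ^ 2)))
    have := nb_comb hξ hinj hφ hd one_pos (c * Polynomial.X ^ (k + 1))
      (c * Polynomial.X ^ k) (c * (Polynomial.X - Polynomial.C l) * Polynomial.X ^ k) (-l)
      (by simp only [Polynomial.C_neg]; ring)
    linarith

lemma nb_step_pow (hξ : ∀ j, ξ j ∈ unitCircle) (hinj : Function.Injective ξ)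
    (hφ : MemBallHinf φ) (hd : HbDecompOf ξ m φ g P) (c : Polynomial ℂ) {l : ℂ} (hl : ‖l‖ < 1)
    (N : ℕ) :
    (Summable fun k => nb ξ m φ (c * (Polynomial.X - Polynomial.C l) ^ N * Polynomial.X ^ k)) ↔
      Summable fun k => nb ξ m φ (c * Polynomial.X ^ k) := by
  induction N with
  | zero => simp
  | succ N ih =>
    rw [← ih, ← nb_step hξ hinj hφ hd (c * (Polynomial.X - Polynomial.C l) ^ N) hl]
    simp only [pow_succ, mul_assoc]

lemma nb_step_prod (hξ : ∀ j, ξ j ∈ unitCircle) (hinj : Function.Injective ξ)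
    (hφ : MemBallHinf φ) (hd : HbDecompOf ξ m φ g P) (c : Polynomial ℂ) {Λ : Fin n → ℂ}
    (s : Finset (Fin n)) (hs : ∀ j ∈ s, ‖Λ j‖ < 1) :
    (Summable fun k => nb ξ m φ (c * (∏ j ∈ s, (Polynomial.X - Polynomial.C (Λ j)) ^ (m j)) *
      Polynomial.X ^ k)) ↔
      Summable fun k => nb ξ m φ (c * Polynomial.X ^ k) := by
  induction s using Finset.induction_on with
  | empty => simp
  | insert a s ha ih =>
    rw [← ih fun j hj => hs j (Finset.mem_insert_of_mem hj),
      ← nb_step_pow hξ hinj hφ hd (c * ∏ j ∈ s, (Polynomial.X - Polynomial.C (Λ j)) ^ (m j)) (hs a (Finset.mem_insert_self _ _)) (m a),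
      Finset.prod_insert ha]
    refine summable_congr fun k => ?_
    congr 1; ring

lemma q_coeff_tendsto (hξ : ∀ j, ξ j ∈ unitCircle) (hinj : Function.Injective ξ)
    (hφ : MemBallHinf φ) (hd : HbDecompOf ξ m φ g P) (c : ℕ → Polynomial ℂ)
    (hs : Summable fun k => nb ξ m φ (c k)) (i : ℕ) :
    Tendsto (fun k => (((c k).comp P) %ₘ a1p ξ m).coeff i) atTop (nhds 0) := by
  rw [tendsto_zero_iff_norm_tendsto_zero]
  have h1 : Tendsto (fun k => Real.sqrt (nb ξ m φ (c k))) atTop (nhds 0) := by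
    have := (Real.continuous_sqrt.tendsto _).comp hs.tendsto_atTop_zero
    simpa [Function.comp_def] using this
  refine squeeze_zero (fun _ => norm_nonneg _) (fun k => ?_) h1
  apply Real.le_sqrt_of_sq_le
  obtain ⟨G, hG⟩ := decomp_phi hφ hd (c k)
  rw [nb, hbNormSq_eq hξ hinj hG, ← taylorCoeff_poly]
  have h2 := (memH2_poly (((c k).comp P) %ₘ a1p ξ m)).2.le_tsum i fun _ _ => by positivity
  have := h2NormSq_nonneg G
  refine h2.trans ?_
  change h2NormSq _ ≤ _
  linarith

lemma taylor_coeff_tendsto (q : ℕ → Polynomial ℂ) (N : ℕ) (hN : ∀ k, (q k).natDegree < N)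
    (h : ∀ i, Tendsto (fun k => (q k).coeff i) atTop (nhds 0)) (w : ℂ) (d : ℕ) :
    Tendsto (fun k => (Polynomial.taylor w (q k)).coeff d) atTop (nhds 0) := by
  have e : ∀ k, (Polynomial.taylor w (q k)).coeff d =
      ∑ i ∈ Finset.range N, (q k).coeff i * (Polynomial.taylor w (Polynomial.X ^ i)).coeff d := by
    intro k
    conv_lhs => rw [(q k).as_sum_range_C_mul_X_pow' (hN k)]
    simp only [map_sum, Polynomial.finset_sum_coeff, Polynomial.taylor_mul, Polynomial.taylor_C,
      Polynomial.coeff_C_mul]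
  simp only [e]
  have := tendsto_finset_sum (Finset.range N) fun i _ =>
    (h i).mul_const ((Polynomial.taylor w (Polynomial.X ^ i)).coeff d)
  simpa using this

lemma taylor_coeff_low {w : ℂ} {d M : ℕ} (hdM : d < M) {q : Polynomial ℂ}
    (h : (Polynomial.X - Polynomial.C w) ^ M ∣ q) : (Polynomial.taylor w q).coeff d = 0 := by
  obtain ⟨r, rfl⟩ := h
  rw [Polynomial.taylor_mul, Polynomial.taylor_pow]
  simp only [map_sub, Polynomial.taylor_X, Polynomial.taylor_C, add_sub_cancel_right]
  rw [Polynomial.coeff_X_pow_mul', if_neg (by omega)]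

lemma dvd_of_summable (hξ : ∀ j, ξ j ∈ unitCircle) (hinj : Function.Injective ξ)
    (hφ : MemBallHinf φ) (hd : HbDecompOf ξ m φ g P) (c : Polynomial ℂ) (j : Fin n)
    (hP : ‖P.eval (ξ j)‖ = 1)
    (hs : Summable fun k => nb ξ m φ (c * Polynomial.X ^ k)) :
    (Polynomial.X - Polynomial.C (ξ j)) ^ (m j) ∣ c.comp P := by
  set D := c.comp P with hD
  by_cases hq : D = 0
  · rw [hq]; exact dvd_zero _
  obtain ⟨D', hD', hnd⟩ := Polynomial.exists_eq_pow_rootMultiplicity_mul_and_not_dvd D hq (ξ j)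
  set d := Polynomial.rootMultiplicity (ξ j) D
  by_cases hdm : m j ≤ d
  · rw [hD']; exact (pow_dvd_pow _ hdm).mul_right _
  exfalso
  push Not at hdm
  rw [Polynomial.dvd_iff_isRoot, Polynomial.IsRoot] at hnd
  apply hnd
  set q : ℕ → Polynomial ℂ := fun k => ((c * Polynomial.X ^ k).comp P) %ₘ a1p ξ m with hqdef
  have hN : ∀ k, (q k).natDegree < ∑ j, m j := by
    intro k
    have hpos : 0 < ∑ j, m j := lt_of_lt_of_le (by omega)
      (Finset.single_le_sum (f := m) (fun _ _ => Nat.zero_le _) (Finset.mem_univ j))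
    have := Polynomial.degree_modByMonic_lt ((c * Polynomial.X ^ k).comp P) (a1p_monic ξ m)
    rw [a1p_degree] at this
    by_cases h0 : q k = 0
    · rw [h0]; simpa using hpos
    · exact (Polynomial.natDegree_lt_iff_degree_lt h0).2 this
  have t1 := taylor_coeff_tendsto q _ hN (q_coeff_tendsto hξ hinj hφ hd _ hs) (ξ j) d
  have e : ∀ k, (Polynomial.taylor (ξ j) (q k)).coeff d = D'.eval (ξ j) * (P.eval (ξ j)) ^ k := by
    intro k
    have h1 : q k = D * P ^ k - a1p ξ m * (((c * Polynomial.X ^ k).comp P) /ₘ a1p ξ m) := by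
      have := Polynomial.modByMonic_add_div ((c * Polynomial.X ^ k).comp P) (a1p ξ m)
      have e3 : (c * Polynomial.X ^ k).comp P = D * P ^ k := by
        rw [Polynomial.mul_comp, Polynomial.X_pow_comp]
      rw [← e3]
      linear_combination this
    have h2 : (Polynomial.X - Polynomial.C (ξ j)) ^ (m j) ∣
        a1p ξ m * (((c * Polynomial.X ^ k).comp P) /ₘ a1p ξ m) :=
      (Finset.dvd_prod_of_mem _ (Finset.mem_univ j)).mul_right _
    rw [h1, map_sub, Polynomial.coeff_sub, taylor_coeff_low hdm h2, sub_zero, hD', mul_assoc,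
      Polynomial.taylor_mul, Polynomial.taylor_pow]
    simp only [map_sub, Polynomial.taylor_X, Polynomial.taylor_C, add_sub_cancel_right]
    rw [Polynomial.coeff_X_pow_mul', if_pos le_rfl, Nat.sub_self, Polynomial.taylor_coeff_zero]
    simp
  simp only [e] at t1
  have t2 := t1.norm
  simp only [norm_mul, norm_pow, hP, one_pow, mul_one, norm_zero] at t2
  exact norm_eq_zero.1 (tendsto_nhds_unique tendsto_const_nhds t2)

end

section
variable {n : ℕ} {ξ : Fin n → ℂ} {m : Fin n → ℕ} {φ g : ℂ → ℂ} {P : Polynomial ℂ}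

/-- The polynomial `∏_{j ≥ p} (X - Λ_j)^{m_j}`. -/
def Bp {n : ℕ} (p : ℕ) (m : Fin n → ℕ) (Λ : Fin n → ℂ) : Polynomial ℂ :=
  ∏ j ∈ Finset.univ.filter fun j : Fin n => p ≤ (j : ℕ),
    (Polynomial.X - Polynomial.C (Λ j)) ^ (m j)

lemma ufun_eq (p : ℕ) (Λ : Fin n → ℂ) (z : ℂ) :
    ufun p ξ m Λ φ z = (a1p ξ m * Bp p m Λ).eval (φ z) / a1fun ξ m z := by
  rw [Polynomial.eval_mul, a1p_eval, Bp, Polynomial.eval_prod, ufun]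
  simp

lemma ufun_diff (hξ : ∀ j, ξ j ∈ unitCircle) (hφ : MemBallHinf φ) (p : ℕ) (Λ : Fin n → ℂ) :
    DifferentiableOn ℂ (ufun p ξ m Λ φ) unitDisk := by
  have h1 : ufun p ξ m Λ φ = fun z => (a1p ξ m * Bp p m Λ).eval (φ z) / (a1p ξ m).eval z := by
    funext z; rw [ufun_eq, a1p_eval]
  rw [h1]
  refine DifferentiableOn.div ?_ (a1p ξ m).differentiable.differentiableOn ?_
  · exact (a1p ξ m * Bp p m Λ).differentiable.comp_differentiableOn hφ.1
  · intro z hz; rw [a1p_eval]; exact a1fun_ne hξ hz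

lemma dvd_comp (hξ : ∀ j, ξ j ∈ unitCircle) (hinj : Function.Injective ξ) (hm : ∀ j, 0 < m j)
    (hφ : MemBallHinf φ) (hd : HbDecompOf ξ m φ g P)
    {Λ : Fin n → ℂ} (hΛ : ∀ j, NTLimit φ (ξ j) (Λ j)) {p : ℕ}
    (hΛcirc : ∀ j : Fin n, (j : ℕ) < p → ∃ i, Λ j = ξ i)
    (hs : Summable fun k => nb ξ m φ (a1p ξ m * Bp p m Λ * Polynomial.X ^ k)) :
    a1p ξ m ∣ (a1p ξ m * Bp p m Λ).comp P := by
  refine Finset.prod_dvd_of_coprime ?_ ?_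
  · intro i _ j _ hij
    apply IsCoprime.pow
    exact Polynomial.pairwise_coprime_X_sub_C hinj hij
  · intro j _
    by_cases hj : (j : ℕ) < p
    · refine dvd_of_summable hξ hinj hφ hd _ j ?_ hs
      obtain ⟨i, hi⟩ := hΛcirc j hj
      rw [P_eval hξ hm hd hΛ, hi]
      simpa [unitCircle] using hξ i
    · rw [Polynomial.mul_comp]
      refine Dvd.dvd.mul_left ?_ _
      rw [Bp, Polynomial.prod_comp]
      refine Dvd.dvd.trans ?_ (Finset.dvd_prod_of_mem _ (a := j) (by simpa using hj))
      rw [Polynomial.pow_comp]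
      apply pow_dvd_pow_of_dvd
      rw [Polynomial.dvd_iff_isRoot]
      simp [P_eval hξ hm hd hΛ]

lemma summ_iff (hξ : ∀ j, ξ j ∈ unitCircle) (hinj : Function.Injective ξ) (hm : ∀ j, 0 < m j)
    (hφ : MemBallHinf φ) (hd : HbDecompOf ξ m φ g P)
    {Λ : Fin n → ℂ} (hΛ : ∀ j, NTLimit φ (ξ j) (Λ j)) {p : ℕ}
    (hΛcirc : ∀ j : Fin n, (j : ℕ) < p → ∃ i, Λ j = ξ i)
    (hΛdisk : ∀ j : Fin n, p ≤ (j : ℕ) → Λ j ∈ unitDisk) :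
    (Summable fun k => nb ξ m φ (a1p ξ m * Polynomial.X ^ k)) ↔
      ∑' k, Hn (fun z => ufun p ξ m Λ φ z * φ z ^ k) < ⊤ := by
  rw [← nb_step_prod hξ hinj hφ hd (a1p ξ m) (Λ := Λ)
    (Finset.univ.filter fun j : Fin n => p ≤ (j : ℕ)) (fun j hj => by
      have := hΛdisk j (by simpa using hj)
      simpa [unitDisk] using this)]
  change (Summable fun k => nb ξ m φ (a1p ξ m * Bp p m Λ * Polynomial.X ^ k)) ↔ _
  have dec0 : ∀ k, MemH2 (fun z => ufun p ξ m Λ φ z * φ z ^ k) →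
      HbDecompOf ξ m (fun z => (a1p ξ m * Bp p m Λ * Polynomial.X ^ k).eval (φ z))
        (fun z => ufun p ξ m Λ φ z * φ z ^ k) 0 := by
    intro k hk
    refine ⟨hk, by rw [Polynomial.degree_zero]; exact WithBot.bot_lt_coe _, fun z hz => ?_⟩
    have := a1fun_ne (m := m) hξ hz
    beta_reduce
    rw [ufun_eq, Polynomial.eval_mul]
    simp only [Polynomial.eval_pow, Polynomial.eval_X, Polynomial.eval_zero]
    field_simp
    ring
  have nbeq : ∀ k, MemH2 (fun z => ufun p ξ m Λ φ z * φ z ^ k) →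
      nb ξ m φ (a1p ξ m * Bp p m Λ * Polynomial.X ^ k) =
        (Hn (fun z => ufun p ξ m Λ φ z * φ z ^ k)).toReal := by
    intro k hk
    rw [nb, hbNormSq_eq hξ hinj (dec0 k hk), h2NormSq_eq]
    have : h2NormSq (fun z => (0 : Polynomial ℂ).eval z) = 0 := by
      simp only [h2NormSq, taylorCoeff_poly]; simp
    rw [this, add_zero]
  have dff : ∀ k, DifferentiableOn ℂ (fun z => ufun p ξ m Λ φ z * φ z ^ k) unitDisk :=
    fun k => (ufun_diff hξ hφ p Λ).mul (hφ.1.pow k)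
  constructor
  · intro hs
    have hdv := dvd_comp hξ hinj hm hφ hd hΛ hΛcirc hs
    have hmem : ∀ k, MemH2 (fun z => ufun p ξ m Λ φ z * φ z ^ k) := by
      intro k
      obtain ⟨G, hG⟩ := decomp_phi hφ hd (a1p ξ m * Bp p m Λ * Polynomial.X ^ k)
      have h0 : ((a1p ξ m * Bp p m Λ * Polynomial.X ^ k).comp P) %ₘ a1p ξ m = 0 := by
        rw [Polynomial.modByMonic_eq_zero_iff_dvd (a1p_monic ξ m), Polynomial.mul_comp]
        exact hdv.mul_right _
      rw [h0] at hG
      refine hG.1.congr fun z hz => ?_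
      have h1 := hG.2.2 z hz
      beta_reduce at h1
      have := a1fun_ne (m := m) hξ hz
      rw [ufun_eq]
      rw [Polynomial.eval_mul] at h1
      simp only [Polynomial.eval_pow, Polynomial.eval_X, Polynomial.eval_zero, add_zero] at h1
      rw [div_mul_eq_mul_div, h1]
      field_simp
    have h2 : ∀ k, Hn (fun z => ufun p ξ m Λ φ z * φ z ^ k) =
        ENNReal.ofReal (nb ξ m φ (a1p ξ m * Bp p m Λ * Polynomial.X ^ k)) := by
      intro k
      rw [nbeq k (hmem k), ENNReal.ofReal_toReal (memH2_iff.1 (hmem k)).2.ne]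
    simp only [h2]
    rw [← ENNReal.ofReal_tsum_of_nonneg (fun _ => nb_nonneg _) hs]
    exact ENNReal.ofReal_lt_top
  · intro h
    have hmem : ∀ k, MemH2 (fun z => ufun p ξ m Λ φ z * φ z ^ k) := fun k =>
      memH2_iff.2 ⟨dff k, (ENNReal.le_tsum k).trans_lt h⟩
    simp only [fun k => nbeq k (hmem k)]
    exact ENNReal.summable_toReal h.ne

lemma poly_sum (q : Polynomial ℂ) (N : ℕ) (h : q.degree < (N : WithBot ℕ)) :
    q = ∑ i ∈ Finset.range N, Polynomial.C (q.coeff i) * Polynomial.X ^ i := by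
  ext k
  rw [Polynomial.finsetSum_coeff]
  simp only [Polynomial.coeff_C_mul_X_pow, Finset.sum_ite_eq, Finset.mem_range]
  split_ifs with hk
  · rfl
  · apply Polynomial.coeff_eq_zero_of_degree_lt
    exact h.trans_le (by exact_mod_cast not_lt.1 hk)

lemma nb_poly (hξ : ∀ j, ξ j ∈ unitCircle) (hinj : Function.Injective ξ)
    (hφ : MemBallHinf φ) (hd : HbDecompOf ξ m φ g P) (N : ℕ) :
    ∃ C : ℝ, 0 ≤ C ∧ ∀ d : ℕ → ℂ, nb ξ m φ (∑ i ∈ Finset.range N,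
      Polynomial.C (d i) * Polynomial.X ^ i) ≤ C * ∑ i ∈ Finset.range N, ‖d i‖ ^ 2 := by
  induction N with
  | zero =>
    refine ⟨0, le_rfl, fun d => ?_⟩
    have := hbNormSq_const_mul_le hξ hinj 0 (mem_phi hφ hd 0)
    simpa [nb] using this
  | succ N ih =>
    obtain ⟨C, hC, h⟩ := ih
    have hX := nb_nonneg (ξ := ξ) (m := m) (φ := φ) (Polynomial.X ^ N)
    refine ⟨2 * C + 2 * nb ξ m φ (Polynomial.X ^ N), by positivity, fun d => ?_⟩
    have h1 := nb_comb hξ hinj hφ hd one_pos (∑ i ∈ Finset.range N,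
      Polynomial.C (d i) * Polynomial.X ^ i) (Polynomial.X ^ N) _ (d N)
      (Finset.sum_range_succ _ _)
    have h2 := h d
    rw [Finset.sum_range_succ (fun i => ‖d i‖ ^ 2)]
    have h3 : 0 ≤ ∑ i ∈ Finset.range N, ‖d i‖ ^ 2 := Finset.sum_nonneg fun _ _ => by positivity
    have h4 : 0 ≤ ‖d N‖ ^ 2 := by positivity
    nlinarith [mul_nonneg hC h4, mul_nonneg hX h3]

lemma comp_main (hξ : ∀ j, ξ j ∈ unitCircle) (hinj : Function.Injective ξ)
    (hφ : MemBallHinf φ) (hφm : ∀ z ∈ unitDisk, φ z ∈ unitDisk) (hd : HbDecompOf ξ m φ g P)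
    (hs : Summable fun k => nb ξ m φ (a1p ξ m * Polynomial.X ^ k)) {f : ℂ → ℂ} (hf : MemH2 f) :
    ∃ G Q, HbDecompOf ξ m (fun z => a1fun ξ m (φ z) * f (φ z)) G Q ∧
      h2NormSq G + h2NormSq (fun z => Q.eval z) ≤
        2 * (∑' k, nb ξ m φ (a1p ξ m * Polynomial.X ^ k)) * h2NormSq f := by
  choose G hG using fun k => decomp_phi hφ hd (a1p ξ m * Polynomial.X ^ k)
  set q : ℕ → Polynomial ℂ := fun k => ((a1p ξ m * Polynomial.X ^ k).comp P) %ₘ a1p ξ m with hq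
  set S := ∑' k, nb ξ m φ (a1p ξ m * Polynomial.X ^ k) with hS
  set N := ∑ j, m j with hN
  set c := taylorCoeff f with hc
  have hnb : ∀ k, nb ξ m φ (a1p ξ m * Polynomial.X ^ k) =
      h2NormSq (G k) + h2NormSq (fun z => (q k).eval z) := fun k => hbNormSq_eq hξ hinj (hG k)
  have hSnn : 0 ≤ S := tsum_nonneg fun _ => nb_nonneg _
  -- coefficient bound
  have hcoef : ∀ k i, ‖(q k).coeff i‖ ^ 2 ≤ nb ξ m φ (a1p ξ m * Polynomial.X ^ k) := by
    intro k i
    rw [hnb, ← taylorCoeff_poly]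
    have h2 := (memH2_poly (q k)).2.le_tsum i fun _ _ => by positivity
    refine h2.trans ?_
    change h2NormSq _ ≤ _
    linarith [h2NormSq_nonneg (G k)]
  have hsum : ∀ i, Summable fun k => c k * (q k).coeff i := by
    intro i
    refine Summable.of_norm_bounded (hf.2.add hs) fun k => ?_
    rw [norm_mul]
    have := hcoef k i
    have h3 : ‖c k‖ ^ 2 = ‖taylorCoeff f k‖ ^ 2 := rfl
    nlinarith [sq_nonneg (‖c k‖ - ‖(q k).coeff i‖), sq_nonneg ‖c k‖, sq_nonneg ‖(q k).coeff i‖]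
  set Q : Polynomial ℂ := ∑ i ∈ Finset.range N,
    Polynomial.C (∑' k, c k * (q k).coeff i) * Polynomial.X ^ i with hQ
  have hQdeg : Q.degree < (N : WithBot ℕ) := by
    refine (Polynomial.degree_sum_le _ _).trans_lt ?_
    refine (Finset.sup_lt_iff (WithBot.bot_lt_coe N)).2 ?_
    intro i hi
    refine (Polynomial.degree_C_mul_X_pow_le _ _).trans_lt ?_
    exact WithBot.coe_lt_coe.2 (Finset.mem_range.1 hi)
  have hQsum : ∀ z, HasSum (fun k => c k * (q k).eval z) (Q.eval z) := by
    intro z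
    have h1 : ∀ k, c k * (q k).eval z = ∑ i ∈ Finset.range N, (c k * (q k).coeff i) * z ^ i := by
      intro k
      conv_lhs => rw [poly_sum (q k) N (hG k).2.1]
      simp [Polynomial.eval_finsetSum, Finset.mul_sum, mul_assoc]
    have h2 : Q.eval z = ∑ i ∈ Finset.range N, (∑' k, c k * (q k).coeff i) * z ^ i := by
      simp [hQ, Polynomial.eval_finsetSum]
    simp only [h1, h2]
    exact hasSum_sum fun i _ => (hsum i).hasSum.mul_right _
  set F : ℂ → ℂ := fun z => a1fun ξ m (φ z) * f (φ z) with hF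
  have hFsum : ∀ z ∈ unitDisk, HasSum (fun k => c k * (a1fun ξ m z * G k z + (q k).eval z)) (F z) := by
    intro z hz
    have h1 := (taylor_hasSum hf.1 (hφm z hz)).mul_left (a1fun ξ m (φ z))
    refine (Eq.mpr (congrArg (fun w => HasSum w (F z)) ?_) h1)
    funext k
    rw [← (hG k).2.2 z hz]
    simp only [Polynomial.eval_mul, Polynomial.eval_pow, Polynomial.eval_X, a1p_eval, hc]
    ring
  set G' : ℂ → ℂ := fun z => (F z - Q.eval z) / a1fun ξ m z with hG'
  have hGsum : ∀ z ∈ unitDisk, HasSum (fun k => c k * G k z) (G' z) := by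
    intro z hz
    have h1 := ((hFsum z hz).sub (hQsum z)).div_const (a1fun ξ m z)
    have h0 := a1fun_ne (m := m) hξ hz
    refine (Eq.mpr (congrArg (fun w => HasSum w (G' z)) ?_) h1)
    funext k
    rw [eq_div_iff h0]
    ring
  have hdiff : DifferentiableOn ℂ G' unitDisk := by
    have e : G' = fun z => ((a1p ξ m).eval (φ z) * f (φ z) - Q.eval z) / (a1p ξ m).eval z := by
      funext z; simp only [hG', hF, a1p_eval]
    rw [e]
    refine DifferentiableOn.div ?_ (a1p ξ m).differentiable.differentiableOn ?_
    · exact (((a1p ξ m).differentiable.comp_differentiableOn hφ.1).mul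
        (hf.1.comp hφ.1 hφm)).sub Q.differentiable.differentiableOn
    · intro z hz; rw [a1p_eval]; exact a1fun_ne hξ hz
  have bound : ∀ (w : ℕ → ℂ → ℂ) (W : ℂ → ℂ), (∀ k, MemH2 (w k)) →
      (∀ k, h2NormSq (w k) ≤ nb ξ m φ (a1p ξ m * Polynomial.X ^ k)) →
      DifferentiableOn ℂ W unitDisk → (∀ z ∈ unitDisk, HasSum (fun k => c k * w k z) (W z)) →
      MemH2 W ∧ h2NormSq W ≤ S * h2NormSq f := by
    intro w W hw hb hW hsW
    have h1 : Hn W ≤ ENNReal.ofReal (S * h2NormSq f) := by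
      refine Hn_lim (S := fun K z => ∑ k ∈ Finset.range K, c k * w k z) hW ?_ ?_ ?_
      · intro K
        exact DifferentiableOn.fun_sum fun k _ => (hw k).1.const_mul _
      · intro K
        refine (Hn_cs _ c fun k _ => (hw k).1).trans ?_
        rw [mul_comm S, ENNReal.ofReal_mul (h2NormSq_nonneg _)]
        gcongr
        · exact hf.2.sum_le_tsum _ fun _ _ => by positivity
        · have : ∀ k, Hn (w k) = ENNReal.ofReal (h2NormSq (w k)) := fun k =>
            (ofReal_h2NormSq (hw k)).symm
          simp only [this]
          rw [← ENNReal.ofReal_sum_of_nonneg fun _ _ => h2NormSq_nonneg _]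
          apply ENNReal.ofReal_le_ofReal
          exact (Finset.sum_le_sum fun k _ => hb k).trans (hs.sum_le_tsum _ fun _ _ => nb_nonneg _)
      · intro z hz
        exact (hsW z hz).tendsto_sum_nat
    refine ⟨memH2_iff.2 ⟨hW, h1.trans_lt ENNReal.ofReal_lt_top⟩, ?_⟩
    rw [h2NormSq_eq]
    exact ENNReal.toReal_le_of_le_ofReal (mul_nonneg hSnn (h2NormSq_nonneg _)) h1
  have b1 := bound G G' (fun k => (hG k).1)
    (fun k => by rw [hnb]; linarith [h2NormSq_nonneg fun z => (q k).eval z]) hdiff hGsum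
  have b2 := bound (fun k z => (q k).eval z) (fun z => Q.eval z) (fun k => memH2_poly _)
    (fun k => by rw [hnb]; linarith [h2NormSq_nonneg (G k)]) Q.differentiable.differentiableOn
    (fun z _ => hQsum z)
  refine ⟨G', Q, ⟨b1.1, hQdeg, fun z hz => ?_⟩, by linarith [b1.2, b2.2]⟩
  have h0 := a1fun_ne (m := m) hξ hz
  simp only [hG']
  field_simp
  ring

lemma comp_bdd (hξ : ∀ j, ξ j ∈ unitCircle) (hinj : Function.Injective ξ)
    (hφ : MemBallHinf φ) (hφm : ∀ z ∈ unitDisk, φ z ∈ unitDisk) (hd : HbDecompOf ξ m φ g P)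
    (hs : Summable fun k => nb ξ m φ (a1p ξ m * Polynomial.X ^ k)) : CompBddHb ξ m φ := by
  obtain ⟨C, hC, hp⟩ := nb_poly hξ hinj hφ hd (∑ j, m j)
  set S := ∑' k, nb ξ m φ (a1p ξ m * Polynomial.X ^ k) with hS
  have hSnn : 0 ≤ S := tsum_nonneg fun _ => nb_nonneg _
  have key : ∀ f, MemHb ξ m f → MemHb ξ m (fun z => f (φ z)) ∧
      hbNormSq ξ m (fun z => f (φ z)) ≤ (4 * S + 2 * C) * hbNormSq ξ m f := by
    rintro f ⟨⟨f0, q⟩, hf⟩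
    simp only at hf
    obtain ⟨G, Q, h1, h2⟩ := comp_main hξ hinj hφ hφm hd hs hf.1
    have e : EqOn (fun z => a1fun ξ m (φ z) * f0 (φ z) + q.eval (φ z)) (fun z => f (φ z))
        unitDisk := fun z hz => (hf.2.2 _ (hφm z hz)).symm
    have m1 : MemHb ξ m (fun z => a1fun ξ m (φ z) * f0 (φ z)) := ⟨(G, Q), h1⟩
    have m2 := mem_phi hφ hd q
    obtain ⟨gq, m3⟩ : MemHb ξ m (fun z => a1fun ξ m (φ z) * f0 (φ z) + q.eval (φ z)) := by
      obtain ⟨gq, m2⟩ := m2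
      exact ⟨(_, _), h1.add m2⟩
    refine ⟨⟨gq, m3.congr e⟩, ?_⟩
    rw [hbNormSq_eq hξ hinj (m3.congr e), ← hbNormSq_eq hξ hinj m3]
    have h3 := hbNormSq_add_le hξ hinj one_pos m1 m2
    rw [hbNormSq_eq hξ hinj h1] at h3
    have h4 : nb ξ m φ q ≤ C * h2NormSq (fun z => q.eval z) := by
      conv_lhs => rw [poly_sum q _ hf.2.1]
      refine (hp _).trans ?_
      gcongr
      have := (memH2_poly q).2.sum_le_tsum (Finset.range (∑ j, m j)) fun _ _ => by positivity
      simpa only [taylorCoeff_poly, h2NormSq] using this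
    rw [hbNormSq_eq hξ hinj hf]
    unfold nb at h4
    have n1 := mul_nonneg hSnn (h2NormSq_nonneg fun z => q.eval z)
    have n2 := mul_nonneg hC (h2NormSq_nonneg f0)
    linarith
  exact ⟨fun f hf => (key f hf).1, _, fun f hf => (key f hf).2⟩

lemma HS_iff (hξ : ∀ j, ξ j ∈ unitCircle) (hinj : Function.Injective ξ) (hm : ∀ j, 0 < m j)
    (hφ : MemBallHinf φ) (hφm : ∀ z ∈ unitDisk, φ z ∈ unitDisk) (hd : HbDecompOf ξ m φ g P)
    {Λ : Fin n → ℂ} (hΛ : ∀ j, NTLimit φ (ξ j) (Λ j)) {p : ℕ}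
    (hΛcirc : ∀ j : Fin n, (j : ℕ) < p → ∃ i, Λ j = ξ i)
    (hΛdisk : ∀ j : Fin n, p ≤ (j : ℕ) → Λ j ∈ unitDisk) :
    CompHSHb ξ m φ ↔ ∑' k, Hn (fun z => ufun p ξ m Λ φ z * φ z ^ k) < ⊤ := by
  rw [← summ_iff hξ hinj hm hφ hd hΛ hΛcirc hΛdisk]
  have e : (fun k : ℕ => hbNormSq ξ m fun z => a1fun ξ m (φ z) * φ z ^ k) =
      fun k => nb ξ m φ (a1p ξ m * Polynomial.X ^ k) := by
    funext k
    simp [nb, a1p_eval]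
  rw [CompHSHb, e]
  exact ⟨fun h => h.2, fun h => ⟨comp_bdd hξ hinj hφ hφm hd h, h⟩⟩

end

lemma circ_little_o {F : ℂ → ℂ} {θ : ℝ} {D ζ L : ℂ}
    (hD : HasDerivAt (fun t : ℝ => F (exp (t * I))) D θ) (hζ : ζ = exp (θ * I))
    (hL : L * (I * ζ) = D) :
    (fun w => F w - F ζ - L * (w - ζ)) =o[nhdsWithin ζ (Metric.sphere 0 1)] (fun w => w - ζ) := by
  have hζ0 : ζ ≠ 0 := by rw [hζ]; exact exp_ne_zero _
  have hζ1 : ‖ζ‖ = 1 := by rw [hζ, norm_exp_ofReal_mul_I]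
  have he : HasDerivAt (fun t : ℝ => exp (t * I)) (I * ζ) θ := by
    have h1 : HasDerivAt (fun t : ℝ => (t : ℂ) * I) (1 * I) θ :=
      (HasDerivAt.ofReal_comp (hasDerivAt_id θ)).mul_const I
    have := h1.cexp
    rw [← hζ] at this
    convert this using 1; ring
  set H : ℝ → ℂ := fun t => F (exp (t * I)) - F ζ - L * (exp (t * I) - ζ) with hH
  have hH' : HasDerivAt H 0 θ := by
    have := (hD.sub_const (F ζ)).sub ((he.sub_const ζ).const_mul L)
    rw [hL, sub_self] at this
    exact this
  have hH0 : H θ = 0 := by simp [hH, hζ]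
  have ho := hasDerivAt_iff_isLittleO.1 hH'
  simp only [hH0, sub_zero, smul_zero] at ho
  set T : ℂ → ℝ := fun w => θ + (log (w / ζ)).im with hT
  have hlog : HasDerivAt (fun w => log (w / ζ)) (ζ⁻¹) ζ := by
    have h1 : HasDerivAt (fun w => w / ζ) (1 / ζ) ζ := (hasDerivAt_id ζ).div_const ζ
    have := h1.clog (by rw [div_self hζ0]; simp)
    convert this using 1
    field_simp
  have hb := hlog.isBigO_sub
  simp only [div_self hζ0, log_one, sub_zero] at hb
  have hT1 : (fun w => T w - θ) =O[nhds ζ] fun w => w - ζ := by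
    refine Asymptotics.IsBigO.trans ?_ hb
    refine Asymptotics.IsBigO.of_bound 1 (Eventually.of_forall fun w => ?_)
    simp only [hT, add_sub_cancel_left, one_mul, Real.norm_eq_abs]
    exact abs_im_le_norm _
  have hTc : Tendsto T (nhds ζ) (nhds θ) := by
    have h1 : ContinuousAt T ζ := by
      exact continuousAt_const.add (continuous_im.continuousAt.comp hlog.continuousAt)
    have h2 : T ζ = θ := by simp [hT, div_self hζ0]
    rw [← h2]
    exact h1
  have h3 := (ho.comp_tendsto hTc).trans_isBigO hT1
  refine (h3.mono nhdsWithin_le_nhds).congr' ?_ EventuallyEq.rfl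
  filter_upwards [self_mem_nhdsWithin] with w hw
  have hw1 : ‖w‖ = 1 := by simpa using hw
  have hw0 : w ≠ 0 := by rintro rfl; simp at hw1
  have key : exp ((T w : ℂ) * I) = w := by
    have h5 : log (w / ζ) = ((log (w / ζ)).im : ℂ) * I := by
      apply Complex.ext
      · simp [log_re, hw1, hζ1]
      · simp
    simp only [hT]
    push_cast
    rw [add_mul, exp_add, ← hζ, ← h5, exp_log (div_ne_zero hw0 hζ0)]
    field_simp
  simp only [Function.comp, hH, key]

lemma disk_little_o {F : ℂ → ℂ} {K : NNReal} (hF : LipschitzWith K F)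
    (hd : DifferentiableOn ℂ F (Metric.ball 0 1)) {ζ L : ℂ} (hζ : ‖ζ‖ = 1)
    (h : (fun w => F w - F ζ - L * (w - ζ)) =o[nhdsWithin ζ (Metric.sphere 0 1)]
      (fun w => w - ζ)) :
    (fun w => F w - F ζ - L * (w - ζ)) =o[nhdsWithin ζ (Metric.ball 0 1)] (fun w => w - ζ) := by
  set G : ℂ → ℂ := fun w => F w - F ζ - L * (w - ζ) with hG
  have hζ0 : ζ ≠ 0 := by rintro rfl; simp at hζ
  have hGM : ∀ w, ‖G w‖ ≤ (K + ‖L‖) * ‖w - ζ‖ := by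
    intro w
    have h1 := hF.dist_le_mul w ζ
    rw [dist_eq_norm, dist_eq_norm] at h1
    calc ‖G w‖ ≤ ‖F w - F ζ‖ + ‖L * (w - ζ)‖ := norm_sub_le _ _
      _ ≤ _ := by rw [norm_mul]; linarith
  set M := (K : ℝ) + ‖L‖ with hM
  have hM0 : 0 ≤ M := by positivity
  rw [Asymptotics.isLittleO_iff] at h ⊢
  intro c hc
  have hc2 : 0 < c / 2 := by positivity
  have hh := h hc2
  obtain ⟨δ, hδ, hδ2⟩ := Metric.mem_nhdsWithin_iff.1 hh
  -- peak function
  obtain ⟨δ', hδ'0, hδ'1, hδ'⟩ : ∃ δ', 0 < δ' ∧ δ' ≤ 1 ∧ δ' ≤ δ :=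
    ⟨min 1 δ, by positivity, min_le_left _ _, min_le_right _ _⟩
  set ρ := 1 - δ' ^ 2 / 4 with hρ
  have hρ0 : 0 ≤ ρ := by nlinarith
  have hρ1 : ρ < 1 := by nlinarith
  obtain ⟨N, hN⟩ : ∃ N : ℕ, M * ρ ^ N ≤ c / 2 := by
    obtain ⟨N, hN⟩ := exists_pow_lt_of_lt_one (y := ρ) (x := (c / 2) / (M + 1)) (by positivity) hρ1
    refine ⟨N, ?_⟩
    rw [lt_div_iff₀ (by positivity)] at hN
    have : 0 ≤ ρ ^ N := by positivity
    nlinarith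
  set p : ℂ → ℂ := fun w => ((ζ + w) / (2 * ζ)) ^ (2 * N) with hp
  have hpc : Continuous p := by fun_prop
  have hpd : Differentiable ℂ p := by fun_prop
  have hpn : ∀ w, ‖p w‖ = (‖ζ + w‖ ^ 2 / 4) ^ N := by
    intro w
    simp only [hp]
    rw [norm_pow, pow_mul, norm_div, norm_mul, hζ, div_pow]
    norm_num
  have hp1 : p ζ = 1 := by
    simp only [hp]
    rw [← two_mul, div_self (by simpa using hζ0), one_pow]
  have hbd : ∀ w ∈ Metric.sphere (0:ℂ) 1, ‖G w * p w‖ ≤ c / 2 * ‖w - ζ‖ := by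
    intro w hw
    have hw1 : ‖w‖ = 1 := by simpa using hw
    rw [norm_mul, hpn]
    have par : ‖ζ + w‖ ^ 2 + ‖ζ - w‖ ^ 2 = 4 := by
      have := parallelogram_law_with_norm ℝ ζ w
      rw [hζ, hw1] at this
      nlinarith
    have h4 : ‖ζ + w‖ ^ 2 / 4 ≤ 1 := by nlinarith [sq_nonneg ‖ζ - w‖]
    by_cases hwδ : ‖w - ζ‖ < δ
    · have h5 : ‖G w‖ ≤ c / 2 * ‖w - ζ‖ := hδ2 ⟨by simpa [dist_eq_norm] using hwδ, hw⟩
      have h6 : (‖ζ + w‖ ^ 2 / 4) ^ N ≤ 1 := pow_le_one₀ (by positivity) h4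
      calc _ ≤ (c / 2 * ‖w - ζ‖) * 1 := by gcongr
        _ = _ := by ring
    · push Not at hwδ
      have h5 : ‖ζ + w‖ ^ 2 / 4 ≤ ρ := by
        rw [norm_sub_rev] at hwδ
        have : δ' ^ 2 ≤ ‖ζ - w‖ ^ 2 := by
          have := hδ'.trans hwδ
          gcongr
        simp only [hρ]; linarith
      calc ‖G w‖ * (‖ζ + w‖ ^ 2 / 4) ^ N ≤ (M * ‖w - ζ‖) * ρ ^ N := by
            gcongr
            exact hGM w
        _ = (M * ρ ^ N) * ‖w - ζ‖ := by ring
        _ ≤ _ := by gcongr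
  have hin : ∀ z ∈ Metric.ball (0:ℂ) 1, ‖G z * p z‖ ≤ c / 2 * ‖z - ζ‖ := by
    intro z hz
    have hs : ∀ s : ℝ, 1 < s → ‖G z * p z‖ ≤ c / 2 * ‖z - s * ζ‖ := by
      intro s hs
      have hne : ∀ w ∈ Metric.closedBall (0:ℂ) 1, w - s * ζ ≠ 0 := by
        intro w hw h0
        rw [sub_eq_zero] at h0
        have : ‖w‖ ≤ 1 := by simpa using hw
        rw [h0, norm_mul, hζ, norm_real, Real.norm_of_nonneg (by linarith)] at this
        linarith
      have hk : DiffContOnCl ℂ (fun w => G w * p w / (w - s * ζ)) (Metric.ball 0 1) := by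
        constructor
        · refine DifferentiableOn.div ?_ (by fun_prop) fun w hw =>
            hne w (Metric.ball_subset_closedBall hw)
          refine DifferentiableOn.mul ?_ hpd.differentiableOn
          exact (hd.sub_const _).sub (by fun_prop)
        · rw [closure_ball _ one_ne_zero]
          refine ContinuousOn.div ?_ (by fun_prop) hne
          have := hF.continuous
          exact Continuous.continuousOn (by fun_prop)
      have hle := Complex.norm_le_of_forall_mem_frontier_norm_le Metric.isBounded_ball hk
        (C := c / 2) (fun w hw => by
          rw [frontier_ball _ one_ne_zero] at hw
          have h1 := hbd w hw
          have h2 := hne w (Metric.sphere_subset_closedBall hw)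
          rw [norm_div, div_le_iff₀ (norm_pos_iff.2 h2)]
          refine h1.trans ?_
          gcongr
          have hw1 : ‖w‖ = 1 := by simpa using hw
          have e1 : ‖w - s * ζ‖ ^ 2 = ‖w‖ ^ 2 + s ^ 2 * ‖ζ‖ ^ 2 - 2 * s * (w * (starRingEnd ℂ) ζ).re := by
            rw [Complex.sq_norm, Complex.sq_norm, Complex.sq_norm]
            simp [normSq_apply]; ring
          have e2 : ‖w - ζ‖ ^ 2 = ‖w‖ ^ 2 + ‖ζ‖ ^ 2 - 2 * (w * (starRingEnd ℂ) ζ).re := by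
            rw [Complex.sq_norm, Complex.sq_norm, Complex.sq_norm]
            simp [normSq_apply]; ring
          have e3 : (w * (starRingEnd ℂ) ζ).re ≤ 1 := by
            refine (re_le_norm _).trans ?_
            rw [norm_mul, RCLike.norm_conj, hw1, hζ]; norm_num
          have : ‖w - ζ‖ ^ 2 ≤ ‖w - s * ζ‖ ^ 2 := by
            rw [e1, e2, hw1, hζ]; nlinarith
          exact (sq_le_sq₀ (norm_nonneg _) (norm_nonneg _)).1 this)
        (subset_closure hz)
      have h2 := hne z (Metric.ball_subset_closedBall hz)
      rwa [norm_div, div_le_iff₀ (norm_pos_iff.2 h2)] at hle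
    have ht : Tendsto (fun s : ℝ => c / 2 * ‖z - s * ζ‖) (nhdsWithin 1 (Ioi 1))
        (nhds (c / 2 * ‖z - ζ‖)) := by
      have h1 : Tendsto (fun s : ℝ => c / 2 * ‖z - s * ζ‖) (nhds 1)
        (nhds (c / 2 * ‖z - (1:ℝ) * ζ‖)) := Continuous.tendsto (by fun_prop) 1
      simpa using h1.mono_left nhdsWithin_le_nhds
    refine ge_of_tendsto ht ?_
    filter_upwards [self_mem_nhdsWithin] with s hs1 using hs s hs1
  have hev : ∀ᶠ w in nhds ζ, 1 / 2 < ‖p w‖ := by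
    have : Tendsto (fun w => ‖p w‖) (nhds ζ) (nhds ‖p ζ‖) := (hpc.norm.tendsto ζ)
    rw [hp1, norm_one] at this
    exact this.eventually (lt_mem_nhds (by norm_num))
  filter_upwards [nhdsWithin_le_nhds hev, self_mem_nhdsWithin] with z hz1 hz2
  have h1 := hin z hz2
  rw [norm_mul] at h1
  nlinarith [norm_nonneg (G z)]

lemma deriv_radial {F f : ℂ → ℂ} (hd : ∀ z ∈ Metric.ball (0:ℂ) 1, HasDerivAt F (f z) z) {ζ L : ℂ}
    (hζ : ‖ζ‖ = 1)
    (h : (fun w => F w - F ζ - L * (w - ζ)) =o[nhdsWithin ζ (Metric.ball 0 1)] (fun w => w - ζ)) :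
    Tendsto (fun r : ℝ => f (r * ζ)) (nhdsWithin 1 (Iio 1)) (nhds L) := by
  rw [Metric.tendsto_nhdsWithin_nhds]
  intro ε hε
  rw [Asymptotics.isLittleO_iff] at h
  obtain ⟨δ, hδ, hδ2⟩ := Metric.mem_nhdsWithin_iff.1 (h (c := ε / 4) (by positivity))
  refine ⟨min (1 / 2) (δ / 2), by positivity, fun r hr hr2 => ?_⟩
  have hr1 : r < 1 := hr
  rw [Real.dist_eq, abs_of_neg (by linarith)] at hr2
  have hr3 := hr2.trans_le (min_le_left _ _)
  have hr4 := hr2.trans_le (min_le_right _ _)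
  have hnz : ‖(r : ℂ) * ζ‖ = r := by
    rw [norm_mul, hζ, norm_real, Real.norm_of_nonneg (by linarith), mul_one]
  have hnd : ‖(r : ℂ) * ζ - ζ‖ = 1 - r := by
    have e : (r : ℂ) * ζ - ζ = ((r - 1 : ℝ) : ℂ) * ζ := by push_cast; ring
    rw [e, norm_mul, hζ, norm_real, Real.norm_of_nonpos (by linarith)]; ring
  have hsub : Metric.closedBall ((r : ℂ) * ζ) ((1 - r) / 2) ⊆ Metric.ball 0 1 := by
    intro w hw
    rw [mem_closedBall_iff_norm] at hw
    rw [mem_ball_zero_iff]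
    have := norm_add_le (w - r * ζ) (r * ζ)
    rw [sub_add_cancel, hnz] at this
    linarith
  have hdG : ∀ z ∈ Metric.ball (0:ℂ) 1,
      HasDerivAt (fun w => F w - F ζ - L * (w - ζ)) (f z - L) z := by
    intro z hz
    have := ((hd z hz).sub_const (F ζ)).sub (((hasDerivAt_id z).sub_const ζ).const_mul L)
    rw [mul_one] at this
    exact this
  have hmem : (r : ℂ) * ζ ∈ Metric.ball (0:ℂ) 1 := by rw [mem_ball_zero_iff, hnz]; exact hr1
  have hdc : DiffContOnCl ℂ (fun w => F w - F ζ - L * (w - ζ))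
      (Metric.ball ((r : ℂ) * ζ) ((1 - r) / 2)) := by
    have : DifferentiableOn ℂ (fun w => F w - F ζ - L * (w - ζ))
      (Metric.closedBall ((r : ℂ) * ζ) ((1 - r) / 2)) :=
      fun w hw => (hdG w (hsub hw)).differentiableAt.differentiableWithinAt
    exact this.diffContOnCl_ball subset_rfl
  have hC := Complex.norm_deriv_le_of_forall_mem_sphere_norm_le (C := ε / 4 * (3 / 2 * (1 - r)))
    (by linarith : 0 < (1 - r) / 2) hdc (fun w hw => by
      have h1 : ‖w - r * ζ‖ = (1 - r) / 2 := by simpa [dist_eq_norm] using hw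
      have h2 : ‖w - ζ‖ ≤ 3 / 2 * (1 - r) := by
        have := norm_add_le (w - r * ζ) (r * ζ - ζ)
        rw [sub_add_sub_cancel, hnd] at this
        linarith
      have h3 : w ∈ Metric.ball ζ δ := by
        rw [mem_ball_iff_norm]
        linarith
      have h4 : ‖F w - F ζ - L * (w - ζ)‖ ≤ ε / 4 * ‖w - ζ‖ :=
        hδ2 ⟨h3, hsub (Metric.sphere_subset_closedBall hw)⟩
      exact h4.trans (by gcongr))
  rw [(hdG _ hmem).deriv] at hC
  rw [dist_eq_norm]
  refine hC.trans_lt ?_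
  rw [div_lt_iff₀ (by linarith)]
  nlinarith

/-- Fatou's theorem for bounded analytic functions. -/
lemma fatou {f : ℂ → ℂ} (hf : MemHinf f) :
    ∀ᵐ θ : ℝ, ∃ L, Tendsto (fun r : ℝ => f (r * exp (θ * I))) (nhdsWithin 1 (Iio 1)) (nhds L) := by
  obtain ⟨hf, C, hC⟩ := hf
  obtain ⟨F, hF⟩ := hf.isExactOn_ball
  have hlip : LipschitzOnWith (Real.toNNReal C) F (Metric.ball 0 1) := by
    refine Convex.lipschitzOnWith_of_nnnorm_hasDerivWithin_le (convex_ball _ _)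
      (fun z hz => (hF z hz).hasDerivWithinAt) fun z hz => ?_
    have := hC z hz
    rw [← NNReal.coe_le_coe, coe_nnnorm]
    exact this.trans (Real.le_coe_toNNReal C)
  obtain ⟨E, hE, hEq⟩ := hlip.extend_finite_dimension
  have hEd : ∀ z ∈ Metric.ball (0:ℂ) 1, HasDerivAt E (f z) z := by
    intro z hz
    refine (hF z hz).congr_of_eventuallyEq ?_
    filter_upwards [Metric.isOpen_ball.mem_nhds hz] with w hw using (hEq hw).symm
  have hexp : LipschitzWith 1 (fun t : ℝ => exp (t * I)) := by
    refine lipschitzWith_of_nnnorm_deriv_le (by fun_prop) fun t => ?_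
    have h1 : HasDerivAt (fun t : ℝ => (t : ℂ) * I) (1 * I) t :=
      (HasDerivAt.ofReal_comp (hasDerivAt_id t)).mul_const I
    rw [h1.cexp.deriv, ← NNReal.coe_le_coe, coe_nnnorm, norm_mul, norm_exp_ofReal_mul_I]
    simp
  filter_upwards [(hE.comp hexp).ae_differentiableAt_real] with θ hθ
  have hn : ‖exp (θ * I)‖ = 1 := norm_exp_ofReal_mul_I θ
  have hz0 : I * exp (θ * I) ≠ 0 := mul_ne_zero I_ne_zero (exp_ne_zero _)
  set D := deriv (E ∘ fun t : ℝ => exp (t * I)) θ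
  refine ⟨D / (I * exp (θ * I)), ?_⟩
  exact deriv_radial hEd hn (disk_little_o hE
    (fun z hz => (hEd z hz).differentiableAt.differentiableWithinAt) hn
    (circ_little_o hθ.hasDerivAt rfl (div_mul_cancel₀ _ hz0)))

lemma exp_ne_ae (w : ℂ) : ∀ᵐ θ : ℝ, exp (θ * I) ≠ w := by
  rw [ae_iff]
  simp only [not_not, ne_eq]
  apply Set.Countable.measure_zero
  by_cases h : ∃ θ₀ : ℝ, exp (θ₀ * I) = w
  · obtain ⟨θ₀, h0⟩ := h
    refine (Set.countable_range (fun k : ℤ => θ₀ + k * (2 * Real.pi))).mono ?_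
    intro θ hθ
    simp only [mem_setOf_eq] at hθ
    rw [← h0, Complex.exp_eq_exp_iff_exists_int] at hθ
    obtain ⟨k, hk⟩ := hθ
    refine ⟨k, ?_⟩
    have : (θ : ℂ) = ((θ₀ + k * (2 * Real.pi) : ℝ) : ℂ) := by
      apply mul_right_cancel₀ I_ne_zero
      rw [hk]; push_cast; ring
    exact (Complex.ofReal_injective this).symm
  · convert Set.countable_empty
    ext θ
    simp only [mem_setOf_eq, mem_empty_iff_false, iff_false]
    exact fun h' => h ⟨θ, h'⟩

lemma a1_ne_ae {n : ℕ} (ξ : Fin n → ℂ) (m : Fin n → ℕ) :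
    ∀ᵐ θ : ℝ, a1fun ξ m (exp (θ * I)) ≠ 0 := by
  filter_upwards [ae_all_iff.2 fun j => exp_ne_ae (ξ j)] with θ hθ
  rw [a1fun, Finset.prod_ne_zero_iff]
  exact fun j _ => pow_ne_zero _ (sub_ne_zero.2 (hθ j))

/-- A sequence of radii increasing to one. -/
def rseq (k : ℕ) : ℝ := 1 - 1 / ((k : ℝ) + 2)

lemma rseq_mem (k : ℕ) : 0 ≤ rseq k ∧ rseq k < 1 := by
  have h : (0:ℝ) < (k : ℝ) + 2 := by positivity
  have h2 : 1 / ((k : ℝ) + 2) ≤ 1 := by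
    rw [div_le_one h]; linarith [Nat.cast_nonneg (α := ℝ) k]
  have h3 : 0 < 1 / ((k : ℝ) + 2) := by positivity
  exact ⟨by unfold rseq; linarith, by unfold rseq; linarith⟩

lemma rseq_tendsto : Tendsto rseq atTop (nhdsWithin 1 (Iio 1)) := by
  refine tendsto_nhdsWithin_iff.2 ⟨?_, Eventually.of_forall fun k => (rseq_mem k).2⟩
  have h1 : Tendsto (fun k : ℕ => 1 / ((k : ℝ) + 2)) atTop (nhds 0) := by
    have := (tendsto_add_atTop_iff_nat 1).2 (tendsto_one_div_add_atTop_nhds_zero_nat (𝕜 := ℝ))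
    refine this.congr fun k => ?_
    push_cast; ring
  have := h1.const_sub 1
  rw [sub_zero] at this
  exact this

section
variable {n : ℕ} {ξ : Fin n → ℂ} {m : Fin n → ℕ} {φ : ℂ → ℂ}

lemma good_ae (ξ : Fin n → ℂ) (m : Fin n → ℕ) (hφ : MemBallHinf φ) (p : ℕ) (Λ : Fin n → ℂ) :
    ∀ᵐ θ : ℝ, a1fun ξ m (exp (θ * I)) ≠ 0 ∧ ‖bdryVal φ (exp (θ * I))‖ ≤ 1 ∧
      Tendsto (fun r : ℝ => φ (r * exp (θ * I))) (nhdsWithin 1 (Iio 1))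
        (nhds (bdryVal φ (exp (θ * I)))) ∧
      bdryVal (ufun p ξ m Λ φ) (exp (θ * I)) =
        (a1p ξ m * Bp p m Λ).eval (bdryVal φ (exp (θ * I))) / a1fun ξ m (exp (θ * I)) ∧
      Tendsto (fun r : ℝ => ufun p ξ m Λ φ (r * exp (θ * I))) (nhdsWithin 1 (Iio 1))
        (nhds (bdryVal (ufun p ξ m Λ φ) (exp (θ * I)))) := by
  filter_upwards [fatou ⟨hφ.1, 1, hφ.2⟩, a1_ne_ae ξ m] with θ ⟨L, hL⟩ ha
  have e1 : bdryVal φ (exp (θ * I)) = L := hL.limUnder_eq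
  have hz : exp (θ * I) ∈ unitCircle := by simp [unitCircle, norm_exp_ofReal_mul_I]
  have t : Tendsto (fun r : ℝ => ufun p ξ m Λ φ (r * exp (θ * I))) (nhdsWithin 1 (Iio 1))
      (nhds ((a1p ξ m * Bp p m Λ).eval L / a1fun ξ m (exp (θ * I)))) := by
    simp only [ufun_eq, ← a1p_eval] at ha ⊢
    exact (((a1p ξ m * Bp p m Λ).continuous.tendsto L).comp hL).div
      (((a1p ξ m).continuous.tendsto _).comp (rad_tendsto _)) ha
  have e2 : bdryVal (ufun p ξ m Λ φ) (exp (θ * I)) = _ := t.limUnder_eq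
  refine ⟨ha, ?_, by rwa [e1], by rw [e1, e2], by rwa [e2]⟩
  rw [e1]
  refine le_of_tendsto hL.norm ?_
  filter_upwards [Ioo_ev] with r hr using hφ.2 _ (rad_mem hz hr.1 hr.2)

lemma bdry_aemeas {f : ℂ → ℂ} (hf : DifferentiableOn ℂ f unitDisk)
    (h : ∀ᵐ θ : ℝ, Tendsto (fun r : ℝ => f (r * exp (θ * I))) (nhdsWithin 1 (Iio 1))
        (nhds (bdryVal f (exp (θ * I))))) :
    AEMeasurable (fun θ : ℝ => bdryVal f (exp (θ * I))) := by
  refine aemeasurable_of_tendsto_metrizable_ae (μ := volume) (atTop : Filter ℕ)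
    (f := fun (k : ℕ) (θ : ℝ) => f (rseq k * exp (θ * I)))
    (g := fun θ : ℝ => bdryVal f (exp (θ * I))) (fun k => ?_) ?_
  · exact (cont_circ hf (rseq_mem k).1 (rseq_mem k).2).aemeasurable
  · filter_upwards [h] with θ hθ using hθ.comp rseq_tendsto

/-- The perturbed denominator. -/
def aR {n : ℕ} (ξ : Fin n → ℂ) (m : Fin n → ℕ) (R : ℝ) : ℂ → ℂ :=
  fun z => ∏ j, (z - R * ξ j) ^ (m j)

lemma aR_ge (hξ : ∀ j, ξ j ∈ unitCircle) {R : ℝ} (hR : 1 < R) {z : ℂ} (hz : ‖z‖ ≤ 1) :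
    ∏ j, (R - 1) ^ (m j) ≤ ‖aR ξ m R z‖ := by
  rw [aR, norm_prod]
  refine Finset.prod_le_prod (fun _ _ => pow_nonneg (by linarith) _) fun j _ => ?_
  rw [norm_pow]
  refine pow_le_pow_left₀ (by linarith) ?_ _
  have h1 : ‖ξ j‖ = 1 := by simpa [unitCircle] using hξ j
  have h2 := norm_sub_norm_le ((R : ℂ) * ξ j) z
  rw [norm_mul, h1, norm_real, Real.norm_of_nonneg (by linarith), norm_sub_rev] at h2
  linarith

lemma aR_mono (hξ : ∀ j, ξ j ∈ unitCircle) {R : ℝ} (hR : 1 < R) {z : ℂ} (hz : ‖z‖ ≤ 1) :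
    ‖a1fun ξ m z‖ ≤ ‖aR ξ m R z‖ := by
  rw [aR, a1fun, norm_prod, norm_prod]
  refine Finset.prod_le_prod (fun _ _ => norm_nonneg _) fun j _ => ?_
  rw [norm_pow, norm_pow]
  refine pow_le_pow_left₀ (norm_nonneg _) ?_ _
  have h1 : ‖ξ j‖ = 1 := by simpa [unitCircle] using hξ j
  have e1 : ‖z - R * ξ j‖ ^ 2 = ‖z‖ ^ 2 + R ^ 2 * ‖ξ j‖ ^ 2 - 2 * R * (z * (starRingEnd ℂ) (ξ j)).re := by
    rw [Complex.sq_norm, Complex.sq_norm, Complex.sq_norm]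
    simp [normSq_apply]; ring
  have e2 : ‖z - ξ j‖ ^ 2 = ‖z‖ ^ 2 + ‖ξ j‖ ^ 2 - 2 * (z * (starRingEnd ℂ) (ξ j)).re := by
    rw [Complex.sq_norm, Complex.sq_norm, Complex.sq_norm]
    simp [normSq_apply]; ring
  have e3 : (z * (starRingEnd ℂ) (ξ j)).re ≤ 1 := by
    refine (re_le_norm _).trans ?_
    rw [norm_mul, RCLike.norm_conj, h1]; linarith
  have : ‖z - ξ j‖ ^ 2 ≤ ‖z - R * ξ j‖ ^ 2 := by
    rw [e1, e2, h1]; nlinarith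
  exact (sq_le_sq₀ (norm_nonneg _) (norm_nonneg _)).1 this

lemma aR_cont (R : ℝ) : Continuous (aR ξ m R) := by unfold aR; fun_prop

lemma aR_diff (R : ℝ) : Differentiable ℂ (aR ξ m R) := by unfold aR; fun_prop

/-- Upper bound for bounded approximants. -/
lemma HnR_le (hξ : ∀ j, ξ j ∈ unitCircle) (hφ : MemBallHinf φ) (p : ℕ) (Λ : Fin n → ℂ) (k : ℕ)
    {R : ℝ} (hR : 1 < R) :
    Hn (fun z => (a1p ξ m * Bp p m Λ).eval (φ z) * φ z ^ k / aR ξ m R z) ≤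
      (ENNReal.ofReal (2 * Real.pi))⁻¹ * ∫⁻ θ in Ioc (0:ℝ) (2 * Real.pi),
        ‖bdryVal (ufun p ξ m Λ φ) (exp (θ * I))‖ₑ ^ 2 *
          (‖bdryVal φ (exp (θ * I))‖ₑ ^ 2) ^ k := by
  set c := a1p ξ m * Bp p m Λ with hc
  set h : ℂ → ℂ := fun z => c.eval (φ z) * φ z ^ k / aR ξ m R z with hh
  have hρ : 0 < ∏ j, (R - 1) ^ (m j) := Finset.prod_pos fun j _ => pow_pos (by linarith) _
  have hne : ∀ z : ℂ, ‖z‖ ≤ 1 → aR ξ m R z ≠ 0 := fun z hz =>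
    norm_pos_iff.1 (hρ.trans_le (aR_ge hξ hR hz))
  have hdk : ∀ z ∈ unitDisk, ‖z‖ ≤ 1 := fun z hz => by
    have : ‖z‖ < 1 := by simpa [unitDisk] using hz
    exact this.le
  have hdiff : DifferentiableOn ℂ h unitDisk :=
    ((c.differentiable.comp_differentiableOn hφ.1).mul (hφ.1.pow k)).div
      (aR_diff R).differentiableOn fun z hz => hne z (hdk z hz)
  obtain ⟨C, hC⟩ : ∃ C, ∀ z ∈ unitDisk, ‖h z‖ ≤ C := by
    obtain ⟨C, hC⟩ := (isCompact_closedBall (0:ℂ) 1).exists_bound_of_continuousOn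
      c.continuous.continuousOn
    refine ⟨C / ∏ j, (R - 1) ^ (m j), fun z hz => ?_⟩
    simp only [hh]
    rw [norm_div, norm_mul, norm_pow]
    have h1 := hC (φ z) (by simpa using hφ.2 z hz)
    have h2 : ‖φ z‖ ^ k ≤ 1 := pow_le_one₀ (norm_nonneg _) (hφ.2 z hz)
    have h3 := aR_ge (m := m) hξ hR (hdk z hz)
    have h4 : 0 ≤ C := (norm_nonneg _).trans h1
    gcongr
    calc _ ≤ C * 1 := by gcongr
      _ = C := mul_one C
  set J := ∫⁻ θ in Ioc (0:ℝ) (2 * Real.pi),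
        ‖bdryVal (ufun p ξ m Λ φ) (exp (θ * I))‖ₑ ^ 2 *
          (‖bdryVal φ (exp (θ * I))‖ₑ ^ 2) ^ k with hJ
  have hpi : 0 < 2 * Real.pi := by positivity
  refine Hn_le hdiff fun r h0 h1 => ?_
  rw [← mul_assoc, ENNReal.mul_inv_cancel (by simpa using hpi) ENNReal.ofReal_ne_top, one_mul]
  have hlim : Tendsto (fun i => Mr h (rseq i)) atTop (nhds (∫⁻ θ in Ioc (0:ℝ) (2 * Real.pi),
      ‖c.eval (bdryVal φ (exp (θ * I))) * bdryVal φ (exp (θ * I)) ^ k /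
        aR ξ m R (exp (θ * I))‖ₑ ^ 2)) := by
    refine tendsto_lintegral_of_dominated_convergence' (fun _ => ENNReal.ofReal (C ^ 2))
      (fun i => ?_) (fun i => ?_) ?_ ?_
    · have := (cont_circ hdiff (rseq_mem i).1 (rseq_mem i).2)
      exact ((ENNReal.continuous_pow 2).comp this.enorm).aemeasurable
    · refine Eventually.of_forall fun θ => ?_
      beta_reduce
      rw [enorm_sq]
      apply ENNReal.ofReal_le_ofReal
      have := hC _ (circ_mem (rseq_mem i).1 (rseq_mem i).2 θ)
      gcongr
    · simp only [lintegral_const, Measure.restrict_apply_univ, Real.volume_Ioc]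
      exact (ENNReal.mul_lt_top ENNReal.ofReal_lt_top ENNReal.ofReal_lt_top).ne
    · refine ae_restrict_of_ae ?_
      filter_upwards [good_ae ξ m hφ p Λ] with θ hθ
      have hn : ‖exp (θ * I)‖ ≤ 1 := (norm_exp_ofReal_mul_I θ).le
      have t1 := hθ.2.2.1.comp rseq_tendsto
      have t2 := ((((c.continuous.tendsto _).comp t1).mul (t1.pow k)).div
        (((aR_cont (ξ := ξ) (m := m) R).tendsto _).comp ((rad_tendsto (exp (θ * I))).comp rseq_tendsto))
        (hne _ hn))
      exact (ENNReal.continuous_pow 2).tendsto _ |>.comp t2.enorm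
  have hmono : Mr h r ≤ ∫⁻ θ in Ioc (0:ℝ) (2 * Real.pi),
      ‖c.eval (bdryVal φ (exp (θ * I))) * bdryVal φ (exp (θ * I)) ^ k /
        aR ξ m R (exp (θ * I))‖ₑ ^ 2 := by
    refine ge_of_tendsto hlim ?_
    have := (tendsto_nhdsWithin_iff.1 rseq_tendsto).1.eventually (lt_mem_nhds h1)
    filter_upwards [this] with i hi
    exact Mr_mono hdiff h0 hi.le (rseq_mem i).2
  refine hmono.trans (lintegral_mono_ae (ae_restrict_of_ae ?_))
  filter_upwards [good_ae ξ m hφ p Λ] with θ hθ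
  have hn : ‖exp (θ * I)‖ ≤ 1 := (norm_exp_ofReal_mul_I θ).le
  rw [hθ.2.2.2.1, ← hc]
  rw [← pow_mul, mul_comm 2 k, pow_mul, ← mul_pow, ← enorm_pow (bdryVal φ (exp (θ * I))) k, ← enorm_mul, enorm_sq, enorm_sq]
  apply ENNReal.ofReal_le_ofReal
  gcongr ?_ ^ 2
  rw [norm_div, norm_mul, norm_mul, norm_div, div_mul_eq_mul_div]
  have h5 := aR_mono (m := m) hξ hR hn
  have h6 := norm_pos_iff.2 hθ.1
  gcongr

lemma Hn_u_eq (hξ : ∀ j, ξ j ∈ unitCircle) (hφ : MemBallHinf φ) (p : ℕ) (Λ : Fin n → ℂ) (k : ℕ) :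
    ENNReal.ofReal (2 * Real.pi) * Hn (fun z => ufun p ξ m Λ φ z * φ z ^ k) =
      ∫⁻ θ in Ioc (0:ℝ) (2 * Real.pi),
        ‖bdryVal (ufun p ξ m Λ φ) (exp (θ * I))‖ₑ ^ 2 *
          (‖bdryVal φ (exp (θ * I))‖ₑ ^ 2) ^ k := by
  have hpi : 0 < 2 * Real.pi := by positivity
  have hdiff : DifferentiableOn ℂ (fun z => ufun p ξ m Λ φ z * φ z ^ k) unitDisk :=
    (ufun_diff hξ hφ p Λ).mul (hφ.1.pow k)
  apply le_antisymm
  · have h1 : Hn (fun z => ufun p ξ m Λ φ z * φ z ^ k) ≤ (ENNReal.ofReal (2 * Real.pi))⁻¹ *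
        ∫⁻ θ in Ioc (0:ℝ) (2 * Real.pi), ‖bdryVal (ufun p ξ m Λ φ) (exp (θ * I))‖ₑ ^ 2 *
          (‖bdryVal φ (exp (θ * I))‖ₑ ^ 2) ^ k := by
      refine Hn_lim (S := fun K z => (a1p ξ m * Bp p m Λ).eval (φ z) * φ z ^ k /
        aR ξ m (1 + 1 / ((K : ℝ) + 1)) z) hdiff ?_
        (fun K => HnR_le hξ hφ p Λ k (by
          have : 0 < 1 / ((K : ℝ) + 1) := by positivity
          linarith)) ?_
      · intro K
        have hR : 1 < 1 + 1 / ((K : ℝ) + 1) := by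
          have : 0 < 1 / ((K : ℝ) + 1) := by positivity
          linarith
        refine (((a1p ξ m * Bp p m Λ).differentiable.comp_differentiableOn hφ.1).mul
          (hφ.1.pow k)).div (aR_diff _).differentiableOn fun z hz => ?_
        have hz1 : ‖z‖ < 1 := by simpa [unitDisk] using hz
        have hρ : 0 < ∏ j, (1 + 1 / ((K : ℝ) + 1) - 1) ^ (m j) :=
          Finset.prod_pos fun j _ => pow_pos (by linarith) _
        exact norm_pos_iff.1 (hρ.trans_le (aR_ge hξ hR hz1.le))
      · intro z hz
        have t1 : Tendsto (fun K : ℕ => 1 + 1 / ((K : ℝ) + 1)) atTop (nhds 1) := by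
          have := (tendsto_one_div_add_atTop_nhds_zero_nat (𝕜 := ℝ)).const_add 1
          rwa [add_zero] at this
        have c1 : Continuous fun R : ℝ => aR ξ m R z := by unfold aR; fun_prop
        have t2 := (c1.tendsto 1).comp t1
        have e : aR ξ m 1 z = a1fun ξ m z := by simp [aR, a1fun]
        rw [e] at t2
        have t3 := (tendsto_const_nhds (x := (a1p ξ m * Bp p m Λ).eval (φ z) * φ z ^ k)).div t2
          (a1fun_ne hξ hz)
        rw [ufun_eq, div_mul_eq_mul_div]
        exact t3
    calc _ ≤ ENNReal.ofReal (2 * Real.pi) * ((ENNReal.ofReal (2 * Real.pi))⁻¹ *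
        ∫⁻ θ in Ioc (0:ℝ) (2 * Real.pi), ‖bdryVal (ufun p ξ m Λ φ) (exp (θ * I))‖ₑ ^ 2 *
          (‖bdryVal φ (exp (θ * I))‖ₑ ^ 2) ^ k) := by
          gcongr
      _ = _ := by
        rw [← mul_assoc, ENNReal.mul_inv_cancel (by simpa using hpi) ENNReal.ofReal_ne_top, one_mul]
  · have hm : ∀ i, Measurable fun θ : ℝ =>
        ‖ufun p ξ m Λ φ (rseq i * exp (θ * I)) * φ (rseq i * exp (θ * I)) ^ k‖ₑ ^ 2 := by
      intro i
      have := (cont_circ hdiff (rseq_mem i).1 (rseq_mem i).2)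
      exact ((ENNReal.continuous_pow 2).comp this.enorm).measurable
    calc _ = ∫⁻ θ in Ioc (0:ℝ) (2 * Real.pi), liminf (fun i =>
          ‖ufun p ξ m Λ φ (rseq i * exp (θ * I)) * φ (rseq i * exp (θ * I)) ^ k‖ₑ ^ 2) atTop := by
          refine lintegral_congr_ae (ae_restrict_of_ae ?_)
          filter_upwards [good_ae ξ m hφ p Λ] with θ hθ
          have t1 := (hθ.2.2.2.2.comp rseq_tendsto).mul ((hθ.2.2.1.comp rseq_tendsto).pow k)
          have t2 := ((ENNReal.continuous_pow 2).tendsto _).comp t1.enorm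
          rw [← pow_mul, mul_comm 2 k, pow_mul, ← mul_pow, ← enorm_pow (bdryVal φ (exp (θ * I))) k,
            ← enorm_mul]
          exact t2.liminf_eq.symm
      _ ≤ liminf (fun i => Mr (fun z => ufun p ξ m Λ φ z * φ z ^ k) (rseq i)) atTop :=
          lintegral_liminf_le hm
      _ ≤ _ := by
          refine liminf_le_of_le (by isBoundedDefault) fun b hb => ?_
          obtain ⟨i, hi⟩ := hb.exists
          exact hi.trans (Mr_le_Hn hdiff (rseq_mem i).1 (rseq_mem i).2)

lemma sum_iff_int (hξ : ∀ j, ξ j ∈ unitCircle) (hφ : MemBallHinf φ) (p : ℕ) (Λ : Fin n → ℂ) :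
    ∑' k, Hn (fun z => ufun p ξ m Λ φ z * φ z ^ k) < ⊤ ↔
      (∫⁻ θ in Set.Ioc (0:ℝ) (2 * Real.pi),
        ENNReal.ofReal
            (‖bdryVal (ufun p ξ m Λ φ) (Complex.exp (θ * Complex.I))‖ ^ 2) /
          ENNReal.ofReal
            (1 - ‖bdryVal φ (Complex.exp (θ * Complex.I))‖ ^ 2)) < ⊤ := by
  have hpi : 0 < 2 * Real.pi := by positivity
  have m1 : AEMeasurable (fun θ : ℝ => bdryVal φ (exp (θ * I))) :=
    bdry_aemeas hφ.1 ((good_ae ξ m hφ p Λ).mono fun θ h => h.2.2.1)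
  have m2 : AEMeasurable (fun θ : ℝ => bdryVal (ufun p ξ m Λ φ) (exp (θ * I))) :=
    bdry_aemeas (ufun_diff hξ hφ p Λ) ((good_ae ξ m hφ p Λ).mono fun θ h => h.2.2.2.2)
  have e : ENNReal.ofReal (2 * Real.pi) * ∑' k, Hn (fun z => ufun p ξ m Λ φ z * φ z ^ k) =
      ∫⁻ θ in Set.Ioc (0:ℝ) (2 * Real.pi),
        ENNReal.ofReal (‖bdryVal (ufun p ξ m Λ φ) (exp (θ * I))‖ ^ 2) /
          ENNReal.ofReal (1 - ‖bdryVal φ (exp (θ * I))‖ ^ 2) := by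
    rw [← ENNReal.tsum_mul_left]
    simp only [Hn_u_eq hξ hφ p Λ]
    rw [← lintegral_tsum]
    · refine lintegral_congr fun θ => ?_
      rw [ENNReal.tsum_mul_left, ENNReal.tsum_geometric, enorm_sq, enorm_sq,
        ENNReal.ofReal_sub _ (by positivity), ENNReal.ofReal_one, div_eq_mul_inv]
    · intro k
      exact AEMeasurable.restrict ((m2.enorm.pow_const 2).mul ((m1.enorm.pow_const 2).pow_const k))
  rw [← e]
  constructor
  · intro h
    exact ENNReal.mul_lt_top ENNReal.ofReal_lt_top h
  · intro h
    exact ENNReal.lt_top_of_mul_ne_top_right h.ne (by simpa using hpi)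

end

/-- Corollary 5.4. `C_φ` is Hilbert–Schmidt on `H(b)` if and only if
`∫_T |u(ξ)|²/(1 − |φ(ξ)|²) dm(ξ) < ∞`. -/
theorem comp_HS_iff_integral_finite
    (b a : ℂ → ℂ) (n : ℕ) (ξ : Fin n → ℂ) (m : Fin n → ℕ)
    (hset : RationalSetting b a n ξ m)
    (φ : ℂ → ℂ) (hφb : MemHb ξ m φ) (hφball : MemBallHinf φ)
    (hφmap : ∀ z ∈ unitDisk, φ z ∈ unitDisk)
    (Λ : Fin n → ℂ) (hΛ : ∀ j, NTLimit φ (ξ j) (Λ j))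
    (p : ℕ) (hp : p ≤ n)
    (hΛcirc : ∀ j : Fin n, (j : ℕ) < p → ∃ i, Λ j = ξ i)
    (hΛdisk : ∀ j : Fin n, p ≤ (j : ℕ) → Λ j ∈ unitDisk) :
    CompHSHb ξ m φ ↔
      (∫⁻ θ in Set.Ioc (0:ℝ) (2 * Real.pi),
        ENNReal.ofReal
            (‖bdryVal (ufun p ξ m Λ φ) (Complex.exp (θ * Complex.I))‖ ^ 2) /
          ENNReal.ofReal
            (1 - ‖bdryVal φ (Complex.exp (θ * Complex.I))‖ ^ 2)) < ⊤ := by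
  obtain ⟨⟨g, P⟩, hd⟩ := hφb
  exact (HS_iff hset.zeros_mem hset.zeros_inj hset.mult_pos hφball hφmap hd hΛ hΛcirc hΛdisk).trans
    (sum_iff_int hset.zeros_mem hφball p Λ)

end
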